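/- Assume the completion conjecture. Let Γ₁ be a completed primitive graph with a double-triangle configuration whose double-triangle reduction Γ₂ is also completed primitive. Then for all vertices v₁ of Γ₁, v₂ of Γ₂ and every prime power q, [X_{Γ₁∖v₁}]_q ≡ [X_{Γ₂∖v₂}]_q (mod q³); that is, c2(Γ₁∖v₁)_q ≡ c2(Γ₂∖v₂)_q (mod q). -/

import Mathlib

open scoped Classical
open Matrix

/-- The graph polynomial (Kirchhoff polynomial) of a finite simple graph `G`:
`Ψ_G = Σ_T Π_{e ∉ T} x_e`, summed over spanning trees `T` of `G`. -/
noncomputable def graphPoly {V : Type*} [Fintype V] (G : SimpleGraph V) :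
    MvPolynomial G.edgeSet ℤ :=
  letI : Fintype G.edgeSet := Fintype.ofFinite _
  ∑ T : Finset G.edgeSet,
    if (SimpleGraph.fromEdgeSet (Subtype.val '' (T : Set G.edgeSet))).IsTree then
      ∏ e ∈ Tᶜ, MvPolynomial.X e
    else 0

/-- `[X_G]_q`: the number of points `x ∈ K^{E(G)}` with `Ψ_G(x) = 0`. -/
noncomputable def Xcount {V : Type*} [Fintype V] (G : SimpleGraph V)
    (K : Type*) [CommRing K] : ℕ :=
  Nat.card {x : G.edgeSet → K // MvPolynomial.aeval x (graphPoly G) = 0}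

/-- A connected 4-regular simple graph with at least 5 vertices is completed primitive if
removing any 4 edges leaves it either connected or with an isolated vertex. -/
def IsCompletedPrimitive {W : Type*} [Fintype W] (Γ : SimpleGraph W) : Prop :=
  Γ.Connected ∧ (∀ w : W, Nat.card (Γ.neighborSet w) = 4) ∧ 5 ≤ Fintype.card W ∧
  ∀ C : Set (Sym2 W), C ⊆ Γ.edgeSet → Nat.card C = 4 →
    (Γ.deleteEdges C).Connected ∨ ∃ w : W, ∀ u : W, ¬ (Γ.deleteEdges C).Adj w u

/-- `Γ ∖ v`: delete the vertex `v` and all incident edges. -/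
def delVert {W : Type*} (Γ : SimpleGraph W) (v : W) : SimpleGraph ↥{u : W | u ≠ v} :=
  SimpleGraph.induce {u : W | u ≠ v} Γ

/-- A double-triangle configuration `(a,b,c,d,x)` in `Γ`. -/
def DTConfig {W : Type*} (Γ : SimpleGraph W) (a b c d x : W) : Prop :=
  Γ.Adj a b ∧ Γ.Adj a c ∧ Γ.Adj b c ∧ Γ.Adj a d ∧ Γ.Adj b d ∧ c ≠ d ∧
  (∀ y : W, Γ.Adj a y → Γ.Adj b y → y = c ∨ y = d) ∧
  Γ.Adj b x ∧ x ≠ a ∧ x ≠ c ∧ x ≠ d ∧ ¬ Γ.Adj c d ∧ ¬ Γ.Adj a x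

/-- The double-triangle reduction of `Γ` at the configuration `(a,b,c,d,x)`:
delete the vertex `b` and add the edges `cd` and `ax`. -/
def dtReduced {W : Type*} (Γ : SimpleGraph W) (a b c d x : W) :
    SimpleGraph {u : W // u ≠ b} :=
  SimpleGraph.fromRel fun u v =>
    Γ.Adj ↑u ↑v ∨ ((u : W) = c ∧ (v : W) = d) ∨ ((u : W) = a ∧ (v : W) = x)

/-- The completion conjecture: point counts of `Γ ∖ v` modulo `q³` do not depend on `v`. -/
def CompletionConjecture : Prop :=
  ∀ (W : Type) [Fintype W] (Γ : SimpleGraph W), IsCompletedPrimitive Γ →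
    ∀ (v w : W) (K : Type) [Field K] [Fintype K],
      Xcount (delVert Γ v) K ≡ Xcount (delVert Γ w) K [MOD (Fintype.card K) ^ 3]


open Matrix

theorem det_term {K : Type*} [CommRing K] {E V : Type*} [Fintype E] [Fintype V] [DecidableEq E]
    [DecidableEq V] (x : E → K) (B : Matrix E V K) (T : Finset E) :
    Matrix.det (of fun i j : E ⊕ V => if i ∈ (Tᶜ.map Function.Embedding.inl : Finset (E ⊕ V)) then
      (fromBlocks (diagonal x) 0 0 0 : Matrix (E ⊕ V) (E ⊕ V) K) i j else
      (fromBlocks 0 B Bᵀ 0 : Matrix (E ⊕ V) (E ⊕ V) K) i j) =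
    (∏ e ∈ Tᶜ, x e) * det (fromBlocks 0 (B.submatrix (Subtype.val : {e // e ∈ T} → E) id)
      (B.submatrix (Subtype.val : {e // e ∈ T} → E) id)ᵀ 0) := by
  let eq : ({e // ¬ e ∈ T} ⊕ ({e // e ∈ T} ⊕ V)) ≃ E ⊕ V :=
    (Equiv.sumAssoc _ _ _).symm.trans
      (Equiv.sumCongr ((Equiv.sumComm _ _).trans (Equiv.sumCompl (· ∈ T))) (Equiv.refl V))
  rw [← Matrix.det_submatrix_equiv_self eq]
  have : (of fun i j : E ⊕ V => if i ∈ (Tᶜ.map Function.Embedding.inl : Finset (E ⊕ V)) then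
      (fromBlocks (diagonal x) 0 0 0 : Matrix (E ⊕ V) (E ⊕ V) K) i j else
      (fromBlocks 0 B Bᵀ 0 : Matrix (E ⊕ V) (E ⊕ V) K) i j).submatrix eq eq
      = fromBlocks (diagonal fun e : {e // ¬ e ∈ T} => x e) 0
        (of fun i j => Sum.elim (fun _ => 0) (fun v => B j v) i)
        (fromBlocks 0 (B.submatrix (Subtype.val : {e // e ∈ T} → E) id)
      (B.submatrix (Subtype.val : {e // e ∈ T} → E) id)ᵀ 0) := by
    ext i j
    rcases i with ⟨i, hi⟩ | ⟨i, hi⟩ | i <;> rcases j with ⟨j, hj⟩ | ⟨j, hj⟩ | j <;>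
      simp [eq, diagonal_apply, Subtype.ext_iff, *]
    · intro h; exact absurd (h ▸ hj) hi
  rw [this, det_fromBlocks_zero₁₂, det_diagonal]
  congr 1
  exact (Finset.prod_subtype Tᶜ (by simp) x).symm

theorem det_expand {K : Type*} [CommRing K] {E V : Type*} [Fintype E] [Fintype V] [DecidableEq E]
    [DecidableEq V] (x : E → K) (B : Matrix E V K) :
    det (fromBlocks (diagonal x) B Bᵀ 0) = ∑ T : Finset E, (∏ e ∈ Tᶜ, x e) *
      det (fromBlocks 0 (B.submatrix (Subtype.val : {e // e ∈ T} → E) id)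
      (B.submatrix (Subtype.val : {e // e ∈ T} → E) id)ᵀ 0) := by
  have h1 : (fromBlocks (diagonal x) B Bᵀ 0 : Matrix (E ⊕ V) (E ⊕ V) K) =
      fromBlocks (diagonal x) 0 0 0 + fromBlocks 0 B Bᵀ 0 := by
    rw [fromBlocks_add]; simp
  have h2 : det ((fromBlocks (diagonal x) 0 0 0 : Matrix (E ⊕ V) (E ⊕ V) K) + fromBlocks 0 B Bᵀ 0)
      = ∑ S : Finset (E ⊕ V), det (of fun i j : E ⊕ V => if i ∈ S then
      (fromBlocks (diagonal x) 0 0 0 : Matrix (E ⊕ V) (E ⊕ V) K) i j else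
      (fromBlocks 0 B Bᵀ 0 : Matrix (E ⊕ V) (E ⊕ V) K) i j) := by
    refine ((detRowAlternating (n := E ⊕ V) (R := K)).map_add_univ
      (fun i j => (fromBlocks (diagonal x) 0 0 0 : Matrix (E ⊕ V) (E ⊕ V) K) i j)
      (fun i j => (fromBlocks 0 B Bᵀ 0 : Matrix (E ⊕ V) (E ⊕ V) K) i j)).trans ?_
    refine Finset.sum_congr rfl fun S _ => ?_
    have hfun : ∀ f g : E ⊕ V → E ⊕ V → K,
        S.piecewise f g = (fun i j => if i ∈ S then f i j else g i j) := by
      intro f g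
      ext i j
      by_cases h : i ∈ S <;> simp [h]
    exact congrArg (detRowAlternating (n := E ⊕ V) (R := K)) (hfun _ _)
  rw [h1]
  refine h2.trans ?_
  symm
  refine Finset.sum_of_injOn (fun T => Tᶜ.map Function.Embedding.inl) ?_ ?_ ?_ ?_
  · intro S _ T _ h
    simpa using h
  · intro _ _; simp
  · intro S _ hS
    by_cases hV : ∃ v : V, Sum.inr v ∈ S
    · obtain ⟨v, hv⟩ := hV
      refine det_eq_zero_of_row_eq_zero (Sum.inr v) ?_
      intro j
      rcases j with j | j <;> simp [hv]
    · exfalso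
      apply hS
      refine ⟨(Finset.univ.filter fun e => Sum.inl e ∈ S)ᶜ, by simp, ?_⟩
      ext i
      rcases i with i | i
      · simp
      · have := not_exists.1 hV i
        simp [this]
  · intro T _
    exact (det_term x B T).symm

/-- minor, square case -/
theorem det_minor_sq {K : Type*} [CommRing K] {T V : Type*} [Fintype T] [Fintype V] [DecidableEq T]
    [DecidableEq V] (B : Matrix T V K) (σ : V ≃ T) :
    det (fromBlocks 0 B Bᵀ 0) =
      det (fromBlocks 0 1 1 0 : Matrix (V ⊕ V) (V ⊕ V) K) * det (B.submatrix σ id) ^ 2 := by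
  rw [← Matrix.det_submatrix_equiv_self (Equiv.sumCongr σ (Equiv.refl V))]
  have : (fromBlocks 0 B Bᵀ 0).submatrix (Equiv.sumCongr σ (Equiv.refl V))
      (Equiv.sumCongr σ (Equiv.refl V)) =
      fromBlocks (B.submatrix σ id) 0 0 (B.submatrix σ id)ᵀ * fromBlocks 0 1 1 0 := by
    rw [fromBlocks_multiply]
    simp
    ext i j
    rcases i with i | i <;> rcases j with j | j <;> simp
  rw [this, det_mul, det_fromBlocks_zero₁₂, det_transpose]
  ring

theorem det_swap_ne {K : Type*} [Field K] {V : Type*} [Fintype V]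
    [DecidableEq V] : det (fromBlocks 0 1 1 0 : Matrix (V ⊕ V) (V ⊕ V) K) ≠ 0 := by
  intro h
  have := congrArg det (show (fromBlocks 0 1 1 0 : Matrix (V ⊕ V) (V ⊕ V) K) * fromBlocks 0 1 1 0 = 1 by
    rw [fromBlocks_multiply]; simp)
  rw [det_mul, h] at this
  simp at this

theorem det_minor_ne {K : Type*} [Field K] {T V : Type*} [Fintype T] [Fintype V] [DecidableEq T]
    [DecidableEq V] (B : Matrix T V K) (h : Fintype.card T ≠ Fintype.card V) :
    det (fromBlocks 0 B Bᵀ 0) = 0 := by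
  rw [← exists_mulVec_eq_zero_iff]
  rcases lt_or_gt_of_ne h with h | h
  · obtain ⟨v, hv, h0⟩ : ∃ v ≠ 0, B.mulVecLin v = 0 := by
      have := LinearMap.ker_ne_bot_of_finrank_lt (f := B.mulVecLin) (by simpa using h)
      obtain ⟨v, hv, h0⟩ := (Submodule.ne_bot_iff _).1 this
      exact ⟨v, h0, by simpa using hv⟩
    refine ⟨Sum.elim 0 v, ?_, ?_⟩
    · intro h; apply hv; ext i; simpa using congrFun h (Sum.inr i)
    · rw [fromBlocks_mulVec]
      have h0 : B *ᵥ v = 0 := h0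
      simp [h0]
  · obtain ⟨v, hv, h0⟩ : ∃ v ≠ 0, Bᵀ.mulVecLin v = 0 := by
      have := LinearMap.ker_ne_bot_of_finrank_lt (f := Bᵀ.mulVecLin) (by simpa using h)
      obtain ⟨v, hv, h0⟩ := (Submodule.ne_bot_iff _).1 this
      exact ⟨v, h0, by simpa using hv⟩
    refine ⟨Sum.elim v 0, ?_, ?_⟩
    · intro h; apply hv; ext i; simpa using congrFun h (Sum.inl i)
    · rw [fromBlocks_mulVec]
      have h0 : Bᵀ *ᵥ v = 0 := h0
      simp [h0]

section tree
variable {V I : Type*} [Fintype V] [Fintype I] [DecidableEq I]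

/-- integer reduced incidence matrix -/
noncomputable def incM {E V I R : Type*} [Ring R] (s t : E → V) (ι : I → V) : Matrix E I R :=
  of fun e v => (if s e = ι v then 1 else 0) - (if t e = ι v then 1 else 0)

theorem inc_sum {R : Type*} [Ring R] (ι : I → V) (r : V) (hι : Function.Injective ι)
    (hr : ∀ v, v ≠ r → ∃ i, ι i = v) (hr' : ∀ i, ι i ≠ r) (f : V → R) (hf : f r = 0) (u : V) :
    ∑ i, (if u = ι i then 1 else 0) * f (ι i) = f u := by
  by_cases hu : u = r
  · subst hu
    rw [hf]
    refine Finset.sum_eq_zero fun i _ => ?_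
    rw [if_neg (fun h => hr' i h.symm), zero_mul]
  · obtain ⟨j, rfl⟩ := hr u hu
    rw [Finset.sum_eq_single j]
    · simp
    · intro i _ hij
      rw [if_neg (fun h => hij (hι h).symm), zero_mul]
    · simp

theorem tree_det (H : SimpleGraph V) (s t : I → V) (ι : I → V) (r : V)
    (hι : Function.Injective ι)
    (hr : ∀ v, v ≠ r → ∃ i, ι i = v) (hr' : ∀ i, ι i ≠ r)
    (hH : ∀ u v, H.Adj u v → ∃ i, s(s i, t i) = s(u, v)) (hH' : ∀ i, H.Adj (s i) (t i)) :
    (det (incM s t ι : Matrix I I ℤ)) ^ 2 = if H.Connected then 1 else 0 := by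
  split_ifs with hc
  · have key : ∀ v, ∃ z : I → ℤ, ∀ f : V → ℤ, ∑ i, z i * (f (s i) - f (t i)) = f v - f r := by
      intro v
      obtain ⟨w⟩ := hc.preconnected v r
      induction w with
      | nil => exact ⟨0, by simp⟩
      | @cons u v w h p ih =>
        obtain ⟨z, hz⟩ := ih hr hr'
        obtain ⟨i, hi⟩ := hH _ _ h
        rcases Sym2.eq_iff.1 hi with ⟨h1, h2⟩ | ⟨h1, h2⟩
        · refine ⟨fun k => z k + if k = i then 1 else 0, fun f => ?_⟩
          simp only [add_mul, Finset.sum_add_distrib, hz]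
          simp [h1, h2]
        · refine ⟨fun k => z k - if k = i then 1 else 0, fun f => ?_⟩
          simp only [sub_mul, Finset.sum_sub_distrib, hz]
          simp [h1, h2]
    choose z hz using key
    have h1 : (of fun i j => z (ι i) j : Matrix I I ℤ) * incM s t ι = 1 := by
      ext i j
      rw [mul_apply]
      have := hz (ι i) (fun v => if v = ι j then 1 else 0)
      simp only [of_apply, incM]
      rw [this, if_neg (fun h : r = ι j => hr' j h.symm)]
      simp [one_apply, hι.eq_iff]
    have h2 := congrArg det h1
    rw [det_mul, det_one] at h2
    have h3 := IsUnit.of_mul_eq_one_right _ h2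
    exact Int.isUnit_iff.1 h3 |>.elim (fun h => by rw [h]; rfl) (fun h => by rw [h]; rfl)
  · have : ∃ v, ¬ H.Reachable r v := by
      by_contra hcon
      push Not at hcon
      haveI : Nonempty V := ⟨r⟩
      exact hc ⟨fun u v => (hcon u).symm.trans (hcon v)⟩
    obtain ⟨v, hv⟩ := this
    have : det (incM s t ι : Matrix I I ℤ) = 0 := by
      rw [← exists_mulVec_eq_zero_iff]
      refine ⟨fun i => if H.Reachable r (ι i) then 0 else 1, ?_, ?_⟩
      · obtain ⟨i, rfl⟩ := hr v (fun h => hv (h ▸ SimpleGraph.Reachable.refl _))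
        intro h
        have := congrFun h i
        simp [hv] at this
      · ext e
        have := inc_sum ι r hι hr hr' (fun v => if H.Reachable r v then (0:ℤ) else 1) (by simp)
        simp only [mulVec, dotProduct, incM, of_apply, sub_mul, Finset.sum_sub_distrib, this]
        have h1 : H.Reachable r (s e) ↔ H.Reachable r (t e) :=
          ⟨fun h => h.trans (hH' e).reachable, fun h => h.trans (hH' e).symm.reachable⟩
        simp [h1]
    rw [this]; rfl
end tree

theorem minor_tree {V : Type*} [Fintype V] (G : SimpleGraph V)
    (K : Type*) [Field K] {E I : Type*} [Fintype E] [Fintype I] [DecidableEq E] [DecidableEq I]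
    (φ : E ≃ G.edgeSet) (s t : E → V) (hφ : ∀ e, (φ e : Sym2 V) = s(s e, t e))
    (ι : I → V) (r : V) (hι : Function.Injective ι)
    (hr : ∀ v, v ≠ r → ∃ i, ι i = v) (hr' : ∀ i, ι i ≠ r) (T : Finset E) :
    det (fromBlocks 0 ((incM s t ι : Matrix E I K).submatrix (Subtype.val : {e // e ∈ T} → E) id)
      ((incM s t ι : Matrix E I K).submatrix (Subtype.val : {e // e ∈ T} → E) id)ᵀ 0) =
    det (fromBlocks 0 1 1 0 : Matrix (I ⊕ I) (I ⊕ I) K) *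
      if (SimpleGraph.fromEdgeSet (Subtype.val '' ((T.map φ.toEmbedding : Finset G.edgeSet) :
        Set G.edgeSet))).IsTree then 1 else 0 := by
  set H := SimpleGraph.fromEdgeSet (Subtype.val '' ((T.map φ.toEmbedding : Finset G.edgeSet) :
        Set G.edgeSet)) with hH
  have hcardV : Nat.card V = Fintype.card I + 1 := by
    have e : I ⊕ Unit ≃ V := Equiv.ofBijective (Sum.elim ι (fun _ => r)) ⟨by
      rintro (i | i) (j | j) h
      · simpa using hι h
      · exact absurd h (hr' i)
      · exact absurd h.symm (hr' j)
      · rfl, fun v => by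
      by_cases hv : v = r
      · exact ⟨Sum.inr (), hv.symm⟩
      · obtain ⟨i, hi⟩ := hr v hv
        exact ⟨Sum.inl i, hi⟩⟩
    rw [← Nat.card_congr e]; simp
  have hedge : H.edgeSet = Subtype.val '' ((T.map φ.toEmbedding : Finset G.edgeSet) :
        Set G.edgeSet) := by
    rw [hH, SimpleGraph.edgeSet_fromEdgeSet]
    ext e
    simp only [Set.mem_diff]
    refine ⟨fun h => h.1, fun h => ⟨h, ?_⟩⟩
    obtain ⟨e', _, rfl⟩ := h
    exact G.not_isDiag_of_mem_edgeSet e'.2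
  have hcardE : Nat.card H.edgeSet = T.card := by
    rw [hedge, Nat.card_image_of_injective Subtype.val_injective]
    simp [Finset.card_image_of_injective _ φ.injective]
  rw [SimpleGraph.isTree_iff_connected_and_card, hcardE, hcardV]
  by_cases hc : T.card = Fintype.card I
  · have hσ : Fintype.card I = Fintype.card {e // e ∈ T} := by simp [hc]
    let σ : I ≃ {e // e ∈ T} := Fintype.equivOfCardEq hσ
    rw [det_minor_sq _ σ]
    have h1 := tree_det H (fun i => s (σ i)) (fun i => t (σ i)) ι r hι hr hr' (by
      intro u v huv
      rw [← SimpleGraph.mem_edgeSet, hedge] at huv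
      obtain ⟨e', he, h'⟩ := huv
      simp only [Finset.coe_map, Set.mem_image, Finset.mem_coe] at he
      obtain ⟨e, heT, rfl⟩ := he
      refine ⟨σ.symm ⟨e, heT⟩, ?_⟩
      simp only [Equiv.apply_symm_apply]
      rw [← h', ← hφ]; rfl) (by
      intro i
      rw [← SimpleGraph.mem_edgeSet, hedge, ← hφ]
      refine ⟨φ (σ i), ?_, rfl⟩
      simp)
    have h2 : ((incM s t ι : Matrix E I K).submatrix (Subtype.val : {e // e ∈ T} → E) id).submatrix σ id
        = (incM (fun i => s (σ i)) (fun i => t (σ i)) ι : Matrix I I ℤ).map (Int.castRingHom K) := by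
      ext i j
      simp [incM]
    rw [h2, ← RingHom.mapMatrix_apply, ← RingHom.map_det, ← map_pow, h1]
    congr 1
    simp [hc]
  · rw [det_minor_ne _ (by simpa using hc), if_neg (by simp [hc]), mul_zero]

theorem matrix_tree {V : Type*} [Fintype V] (G : SimpleGraph V)
    (K : Type*) [Field K] {E I : Type*} [Fintype E] [Fintype I] [DecidableEq E] [DecidableEq I]
    (φ : E ≃ G.edgeSet) (s t : E → V) (hφ : ∀ e, (φ e : Sym2 V) = s(s e, t e))
    (ι : I → V) (r : V) (hι : Function.Injective ι)
    (hr : ∀ v, v ≠ r → ∃ i, ι i = v) (hr' : ∀ i, ι i ≠ r) (x : E → K) :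
    det (fromBlocks (diagonal x) (incM s t ι) (incM s t ι)ᵀ 0) =
    det (fromBlocks 0 1 1 0 : Matrix (I ⊕ I) (I ⊕ I) K) *
      MvPolynomial.aeval (x ∘ φ.symm) (graphPoly G) := by
  rw [det_expand]
  simp only [minor_tree G K φ s t hφ ι r hι hr hr']
  rw [graphPoly]
  letI : Fintype G.edgeSet := Fintype.ofFinite _
  rw [map_sum, Finset.mul_sum]
  refine Fintype.sum_equiv (Equiv.finsetCongr φ) _ _ fun T => ?_
  rw [Equiv.finsetCongr_apply]
  split_ifs with h
  · rw [map_prod]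
    simp only [MvPolynomial.aeval_X]
    have : (T.map φ.toEmbedding)ᶜ = Tᶜ.map φ.toEmbedding := by
      ext e
      simp
    rw [this, Finset.prod_map]
    simp [mul_comm]
  · simp

theorem Xcount_eq {V : Type*} [Fintype V] (G : SimpleGraph V)
    (K : Type*) [Field K] {E I : Type*} [Fintype E] [Fintype I] [DecidableEq E] [DecidableEq I]
    (φ : E ≃ G.edgeSet) (s t : E → V) (hφ : ∀ e, (φ e : Sym2 V) = s(s e, t e))
    (ι : I → V) (r : V) (hι : Function.Injective ι)
    (hr : ∀ v, v ≠ r → ∃ i, ι i = v) (hr' : ∀ i, ι i ≠ r) :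
    Xcount G K = Nat.card {x : E → K //
      det (fromBlocks (diagonal x) (incM s t ι) (incM s t ι)ᵀ 0) = 0} := by
  rw [Xcount]
  refine Nat.card_congr (Equiv.subtypeEquiv (Equiv.arrowCongr φ.symm (Equiv.refl K)) fun x => ?_)
  rw [matrix_tree G K φ s t hφ ι r hι hr hr', mul_eq_zero, or_iff_right det_swap_ne]
  have : ((φ.symm.arrowCongr (Equiv.refl K)) x) ∘ φ.symm = x := by
    ext e; simp
  rw [this]

/-- version with all vertices compared in an ambient type -/
theorem Xcount_eq' {V W : Type*} [Fintype V] (G : SimpleGraph V) (j : V → W)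
    (hj : Function.Injective j)
    (K : Type*) [Field K] {E I : Type*} [Fintype E] [Fintype I] [DecidableEq E] [DecidableEq I]
    (s t : E → W) (hst : ∀ e, ∃ u v, j u = s e ∧ j v = t e ∧ G.Adj u v)
    (hinj : ∀ e e', s(s e, t e) = s(s e', t e') → e = e')
    (hsurj : ∀ u v, G.Adj u v → ∃ e, s(s e, t e) = s(j u, j v))
    (ι : I → W) (r : V) (hι : Function.Injective ι) (hιm : ∀ i, ∃ v, v ≠ r ∧ j v = ι i)
    (hr : ∀ v, v ≠ r → ∃ i, ι i = j v) :
    Xcount G K = Nat.card {x : E → K //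
      det (fromBlocks (diagonal x) (incM s t ι) (incM s t ι)ᵀ 0) = 0} := by
  choose s' t' hs ht hadj using hst
  choose ι' hι1 hι2 using hιm
  let φ : E ≃ G.edgeSet := Equiv.ofBijective (fun e => ⟨s(s' e, t' e), hadj e⟩) ⟨by
    intro e e' h
    have h1 : s(s' e, t' e) = s(s' e', t' e') := congrArg Subtype.val h
    have h2 := congrArg (Sym2.map j) h1
    simp only [Sym2.map_mk, hs, ht] at h2
    exact hinj _ _ h2, by
    rintro ⟨e, he⟩
    induction e using Sym2.ind with
    | _ u v =>
      obtain ⟨e, he'⟩ := hsurj u v he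
      refine ⟨e, Subtype.ext ?_⟩
      apply Sym2.map.injective hj
      simp only [Sym2.map_mk, hs, ht]
      exact he'⟩
  have h := Xcount_eq G K φ s' t' (fun e => rfl) ι' r
    (fun a b hab => hι (by rw [← hι2, ← hι2, hab]))
    (fun v hv => by
      obtain ⟨i, hi⟩ := hr v hv
      exact ⟨i, hj (by rw [hι2, hi])⟩) hι1
  have h2 : (incM s t ι : Matrix E I K) = incM s' t' ι' := by
    ext e i
    simp [incM, ← hs, ← ht, ← hι2, hj.eq_iff]
  rw [h, h2]

def QQ {K : Type*} [CommRing K] (f0 f1 f2 f3 f4 y1 y2 y3 : K) : K :=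
  f0*(y1*y2+y1*y3+y2*y3)+y1*(f2+f3)+y2*(f1+f3)+y3*(f1+f2)+f4

def S8 {K : Type*} [CommRing K] (y : Fin 2 ⊕ Fin 4 → K) :
    Matrix ((Fin 2 ⊕ Fin 2) ⊕ Fin 4) ((Fin 2 ⊕ Fin 2) ⊕ Fin 4) K :=
  fromBlocks (fromBlocks 0 !![1,-1;0,1] !![1,0;-1,1] (diagonal fun i => y (Sum.inl i)))
    (fromRows !![1,1,0,0;0,0,1,1] 0) (fromRows !![1,1,0,0;0,0,1,1] 0)ᵀ
    (diagonal fun i => y (Sum.inr i))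

def S5 {K : Type*} [CommRing K] (y : Fin 1 ⊕ Fin 3 → K) :
    Matrix ((Fin 1 ⊕ Fin 1) ⊕ Fin 3) ((Fin 1 ⊕ Fin 1) ⊕ Fin 3) K :=
  fromBlocks (fromBlocks 0 1 1 (diagonal fun i => y (Sum.inl i)))
    (fromRows !![1,1,0] 0) (fromRows !![1,1,0] 0)ᵀ
    (diagonal fun i => y (Sum.inr i))

/-- quadratic block -/
def PAP {k : Type*} {K : Type*} [CommRing K] (v w : k → K) (α β γ : K) : Matrix k k K :=
  of fun i j => v i * v j * α + (v i * w j + w i * v j) * γ + w i * w j * β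

theorem PAP_elim {k l : Type*} {K : Type*} [CommRing K] (v w : k → K) (α β γ : K) :
    PAP (Sum.elim (0 : l → K) v) (Sum.elim 0 w) α β γ = fromBlocks 0 0 0 (PAP v w α β γ) := by
  ext i j
  rcases i with i | i <;> rcases j with j | j <;> simp [PAP]

def c8 {K : Type*} [CommRing K] : (Fin 2 ⊕ Fin 2) ⊕ Fin 4 → K := Sum.elim 0 ![-1,0,-1,0]
def d8 {K : Type*} [CommRing K] : (Fin 2 ⊕ Fin 2) ⊕ Fin 4 → K := Sum.elim 0 ![0,-1,0,-1]
def c5 {K : Type*} [CommRing K] : (Fin 1 ⊕ Fin 1) ⊕ Fin 3 → K := Sum.elim 0 ![-1,0,1]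
def d5 {K : Type*} [CommRing K] : (Fin 1 ⊕ Fin 1) ⊕ Fin 3 → K := Sum.elim 0 ![0,-1,-1]

theorem det_blockA {K : Type*} [CommRing K] {k l : Type*} [Fintype k] [DecidableEq k]
    [Fintype l] [DecidableEq l]
    (N N' D : Matrix k k K) (h : N * N' = 1) (B1 : Matrix k l K) (X : Matrix l l K) :
    det (fromBlocks (fromBlocks 0 N Nᵀ D) (fromRows B1 0) (fromRows B1 0)ᵀ X) =
      det (fromBlocks 0 1 1 0 : Matrix (k ⊕ k) (k ⊕ k) K) * det N ^ 2 *
      det (X + (N' * B1)ᵀ * D * (N' * B1)) := by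
  have h' : N' * N = 1 := mul_eq_one_comm.1 h
  have ht : Nᵀ * N'ᵀ = 1 := by rw [← transpose_mul, h', transpose_one]
  have ht' : N'ᵀ * Nᵀ = 1 := by rw [← transpose_mul, h, transpose_one]
  letI : Invertible (fromBlocks 0 N Nᵀ D) := ⟨fromBlocks (-(N'ᵀ * D * N')) N'ᵀ N' 0, by
    rw [fromBlocks_multiply, ← fromBlocks_one]
    simp [h', ht', Matrix.mul_assoc], by
    rw [fromBlocks_multiply, ← fromBlocks_one]
    simp [h, ht, Matrix.mul_assoc]
    rw [← Matrix.mul_assoc Nᵀ, ht]; simp⟩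
  have hinv : ⅟(fromBlocks 0 N Nᵀ D) = fromBlocks (-(N'ᵀ * D * N')) N'ᵀ N' 0 := rfl
  rw [det_fromBlocks₁₁, hinv]
  congr 1
  · have : fromBlocks 0 N Nᵀ D = fromBlocks N 0 D Nᵀ * fromBlocks 0 1 1 0 := by
      rw [fromBlocks_multiply]; simp
    rw [this, det_mul, det_fromBlocks_zero₁₂, det_transpose]
    ring
  · congr 1
    rw [transpose_fromRows, fromCols_mul_fromBlocks, fromCols_mul_fromRows]
    simp [Matrix.mul_assoc]

theorem swap_det {K : Type*} [CommRing K] {k : Type*} [Fintype k] [DecidableEq k] :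
    det (fromBlocks 0 1 1 0 : Matrix (k ⊕ k) (k ⊕ k) K) = (-1) ^ Fintype.card k := by
  have h : (fromBlocks 1 0 (-1) 1 : Matrix (k ⊕ k) (k ⊕ k) K) * (fromBlocks 1 1 0 1 *
      fromBlocks 0 1 1 0) = fromBlocks 1 1 0 (-1) := by
    rw [fromBlocks_multiply, fromBlocks_multiply]; simp
  have h2 := congrArg det h
  simpa [det_mul, det_fromBlocks_zero₁₂, det_fromBlocks_zero₂₁, det_neg] using h2

set_option maxHeartbeats 2000000 in
theorem det8 {K : Type*} [CommRing K] (α β γ : K) (y : Fin 2 ⊕ Fin 4 → K) :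
  det (S8 y - PAP c8 d8 α β γ) =
  QQ (QQ 1 (γ-α) (γ-β) (-γ) (α*β-γ^2) (y (Sum.inr 0)) (y (Sum.inr 1)) (y (Sum.inl 0)))
    (y (Sum.inr 0)*y (Sum.inr 1)*(y (Sum.inl 0)-γ))
    (y (Sum.inr 0)*(y (Sum.inl 0)*(γ-α+(γ-β))+y (Sum.inr 1)*(γ-α)+(α*β-γ^2)))
    (y (Sum.inr 1)*(y (Sum.inl 0)*(γ-α+(γ-β))+y (Sum.inr 0)*(γ-β)+(α*β-γ^2)))
    (y (Sum.inr 0)*y (Sum.inr 1)*(y (Sum.inl 0)*(γ-α+(γ-β))+(α*β-γ^2)))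
    (y (Sum.inl 1)) (y (Sum.inr 2)) (y (Sum.inr 3)) := by
  rw [S8, c8, d8, PAP_elim, sub_eq_add_neg, fromBlocks_neg, fromBlocks_add, neg_zero, neg_zero, neg_zero, add_zero, add_zero, add_zero, ← sub_eq_add_neg]
  have hN : (!![1,0;-1,1] : Matrix (Fin 2) (Fin 2) K) = !![1,-1;0,1]ᵀ := by
    ext i j; fin_cases i <;> fin_cases j <;> simp
  rw [hN, det_blockA !![1,-1;0,1] !![1,1;0,1] _ (by
    ext i j; fin_cases i <;> fin_cases j <;> simp) !![1,1,0,0;0,0,1,1], swap_det]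
  generalize h0 : y (Sum.inl 0) = s
  generalize h1 : y (Sum.inl 1) = y1
  generalize h2 : y (Sum.inr 0) = p
  generalize h3 : y (Sum.inr 1) = r
  generalize h4 : y (Sum.inr 2) = y2
  generalize h5 : y (Sum.inr 3) = y3
  have hX : (diagonal fun i => y (Sum.inr i)) - PAP ![-1,0,-1,0] ![0,-1,0,-1] α β γ +
     (((!![1,1;0,1] : Matrix (Fin 2) (Fin 2) K) * (!![1,1,0,0;0,0,1,1] : Matrix (Fin 2) (Fin 4) K) : Matrix (Fin 2) (Fin 4) K))ᵀ * 
       (diagonal fun i => y (Sum.inl i)) * ((!![1,1;0,1] : Matrix (Fin 2) (Fin 2) K) * (!![1,1,0,0;0,0,1,1] : Matrix (Fin 2) (Fin 4) K))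
      = !![p-α+s,-γ+s,-α+s,-γ+s; -γ+s,r-β+s,-γ+s,-β+s;
      -α+s,-γ+s,y2-α+s+y1,-γ+s+y1; -γ+s,-β+s,-γ+s+y1,y3-β+s+y1] := by
    have hZ : ((!![1,1;0,1] : Matrix (Fin 2) (Fin 2) K) * (!![1,1,0,0;0,0,1,1] : Matrix (Fin 2) (Fin 4) K) : Matrix (Fin 2) (Fin 4) K) =
      !![1,1,1,1;0,0,1,1] := by
      ext i j; fin_cases i <;> fin_cases j <;> simp
    rw [hZ]
    ext i j
    rw [Matrix.add_apply, Matrix.sub_apply, mul_apply, Fin.sum_univ_two]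
    simp only [mul_diagonal, h0, h1]
    fin_cases i <;> fin_cases j <;> simp [PAP, h2, h3, h4, h5] <;> ring
  rw [hX]
  simp [det_succ_row_zero, Fin.sum_univ_succ, Fin.succAbove, QQ]
  ring

set_option maxHeartbeats 2000000 in
theorem det5 {K : Type*} [CommRing K] (α β γ : K) (y : Fin 1 ⊕ Fin 3 → K) :
  det (S5 y - PAP c5 d5 α β γ) =
  - QQ (y (Sum.inr 2) + (γ-α) + (γ-β)) (y (Sum.inr 2) * (γ-α)) (y (Sum.inr 2) * (γ-β))
    (y (Sum.inr 2) * (-γ) + (α*β-γ^2))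
    (y (Sum.inr 2) * (α*β-γ^2)) (y (Sum.inr 0)) (y (Sum.inr 1)) (y (Sum.inl 0)) := by
  rw [S5, c5, d5, PAP_elim, sub_eq_add_neg, fromBlocks_neg, fromBlocks_add, neg_zero, neg_zero, neg_zero, add_zero, add_zero, add_zero, ← sub_eq_add_neg]
  have hN : (fromBlocks 0 1 1 (diagonal fun i => y (Sum.inl i)) :
      Matrix (Fin 1 ⊕ Fin 1) (Fin 1 ⊕ Fin 1) K) =
    fromBlocks 0 1 1ᵀ (diagonal fun i => y (Sum.inl i)) := by rw [transpose_one]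
  rw [hN, det_blockA 1 1 _ (by simp) !![1,1,0], swap_det]
  generalize h0 : y (Sum.inl 0) = s
  generalize h2 : y (Sum.inr 0) = p
  generalize h3 : y (Sum.inr 1) = r
  generalize h4 : y (Sum.inr 2) = e
  have hX : (diagonal fun i => y (Sum.inr i)) - PAP ![-1,0,1] ![0,-1,-1] α β γ +
     (((1 : Matrix (Fin 1) (Fin 1) K) * (!![1,1,0] : Matrix (Fin 1) (Fin 3) K) : Matrix (Fin 1) (Fin 3) K))ᵀ * 
       (diagonal fun i => y (Sum.inl i)) * ((1 : Matrix (Fin 1) (Fin 1) K) * (!![1,1,0] : Matrix (Fin 1) (Fin 3) K))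
      = !![p-α+s,-γ+s,α-γ; -γ+s,r-β+s,γ-β; α-γ, γ-β, e-α+2*γ-β] := by
    rw [Matrix.one_mul]
    ext i j
    rw [Matrix.add_apply, Matrix.sub_apply, mul_apply, Fin.sum_univ_one]
    simp only [mul_diagonal, h0]
    fin_cases i <;> fin_cases j <;> simp [PAP, h2, h3, h4] <;> ring
  rw [hX]
  simp [det_succ_row_zero, Fin.sum_univ_succ, Fin.succAbove, QQ]
  ring

theorem transfer {n κ : Type} [Fintype n] [DecidableEq n]
    (F : ∀ (R : Type) [CommRing R], Matrix n n R → (κ → R) → R)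
    (nat : ∀ (R S : Type) [CommRing R] [CommRing S] (f : R →+* S) (M : Matrix n n R) (y : κ → R),
      f (F R M y) = F S (M.map f) (f ∘ y))
    (hF : ∀ (L : Type) [Field L] (M : Matrix n n L) (y : κ → L), Mᵀ = M → det M ≠ 0 → F L M y = 0)
    (K : Type) [Field K] (M : Matrix n n K) (y : κ → K) (hM : Mᵀ = M) : F K M y = 0 := by
  let MX : Matrix n n (Polynomial K) := charmatrix (-M)
  have h1 : F (Polynomial K) MX (Polynomial.C ∘ y) = 0 := by
    have hinj := IsFractionRing.injective (Polynomial K) (FractionRing (Polynomial K))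
    apply hinj
    rw [map_zero, nat]
    apply hF
    · rw [← transpose_map]
      congr 1
      show (charmatrix (-M))ᵀ = charmatrix (-M)
      rw [← charmatrix_transpose, transpose_neg, hM]
    · have : det (MX.map (algebraMap (Polynomial K) (FractionRing (Polynomial K)))) =
        algebraMap (Polynomial K) (FractionRing (Polynomial K)) (det MX) := by
        rw [RingHom.map_det]; rfl
      rw [this]
      intro h
      have h2 : (-M).charpoly = 0 := hinj (by rw [map_zero]; exact h)
      exact (charpoly_monic (-M)).ne_zero h2
  have h2 := congrArg (Polynomial.evalRingHom 0) h1
  rw [nat, map_zero] at h2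
  convert h2 using 2
  · ext i j
    by_cases hij : i = j
    · subst hij
      simp [MX, charmatrix_apply_eq]
    · simp [MX, charmatrix_apply_ne _ _ _ hij]
  · ext i; simp

def bord {n k K : Type*} [DecidableEq n] [CommRing K] (M : Matrix n n K) (c d : n) (v w : k → K)
    (S : Matrix k k K) : Matrix (n ⊕ k) (n ⊕ k) K :=
  fromBlocks M (of fun i l => (if i = c then v l else 0) + (if i = d then w l else 0))
    (of fun i l => (if i = c then v l else 0) + (if i = d then w l else 0))ᵀ S

theorem bord_map {n k R S : Type*} [DecidableEq n] [CommRing R] [CommRing S] (f : R →+* S)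
    (M : Matrix n n R) (c d : n) (v w : k → R) (X : Matrix k k R) :
    (bord M c d v w X).map f = bord (M.map f) c d (f ∘ v) (f ∘ w) (X.map f) := by
  ext i j
  rcases i with i | i <;> rcases j with j | j <;> simp [bord, apply_ite f]

theorem bord_det {n k K : Type*} [DecidableEq n] [Fintype n] [DecidableEq k] [Fintype k] [Field K]
    (M : Matrix n n K) (hM : Mᵀ = M) (h0 : det M ≠ 0) (c d : n) (v w : k → K)
    (S : Matrix k k K) : det (bord M c d v w S) =
      det M * det (S - PAP v w (M.adjugate c c / det M) (M.adjugate d d / det M)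
        (M.adjugate c d / det M)) := by
  letI : Invertible M := invertibleOfIsUnitDet M (isUnit_iff_ne_zero.2 h0)
  rw [bord, det_fromBlocks₁₁]
  congr 3
  have hadj : M.adjugate d c = M.adjugate c d := by
    have h := adjugate_transpose M
    rw [hM] at h
    exact congrFun (congrFun h c) d
  rw [invOf_eq_nonsing_inv, inv_def, Ring.inverse_eq_inv']
  ext l l'
  simp only [mul_apply, transpose_apply, of_apply, PAP, Matrix.smul_apply, smul_eq_mul]
  simp only [add_mul, mul_add, Finset.sum_add_distrib, ite_mul, mul_ite, zero_mul, mul_zero,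
    Finset.sum_ite_eq', Finset.mem_univ, if_true, Finset.sum_ite_eq]
  rw [hadj]
  field_simp
  ring

def G4 {n K : Type*} [DecidableEq n] [Fintype n] [CommRing K] (M : Matrix n n K) (c d : n) : K :=
  det (bord M c d ![1,0] ![0,1] (0 : Matrix (Fin 2) (Fin 2) K))

theorem map_det' {n R S : Type*} [DecidableEq n] [Fintype n] [CommRing R] [CommRing S]
    (f : R →+* S) (M : Matrix n n R) : f (det M) = det (M.map f) := by
  rw [RingHom.map_det]; rfl

theorem map_adj' {n R S : Type*} [DecidableEq n] [Fintype n] [CommRing R] [CommRing S]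
    (f : R →+* S) (M : Matrix n n R) (i j : n) :
    f (adjugate M i j) = adjugate (M.map f) i j := by
  have := RingHom.map_adjugate f M
  exact congrFun (congrFun this i) j

theorem map_G4 {n R S : Type*} [DecidableEq n] [Fintype n] [CommRing R] [CommRing S]
    (f : R →+* S) (M : Matrix n n R) (c d : n) : f (G4 M c d) = G4 (M.map f) c d := by
  rw [G4, map_det', bord_map, G4]
  congr 2
  · ext i; fin_cases i <;> simp
  · ext i; fin_cases i <;> simp
  · ext i j; simp

theorem G4_inv {n K : Type*} [DecidableEq n] [Fintype n] [Field K]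
    (M : Matrix n n K) (hM : Mᵀ = M) (h0 : det M ≠ 0) (c d : n) :
    G4 M c d = det M * ((M.adjugate c c / det M) * (M.adjugate d d / det M) -
        (M.adjugate c d / det M) ^ 2) := by
  rw [G4, bord_det M hM h0]
  congr 1
  simp [det_fin_two, PAP]
  ring

theorem G4_rel {n K : Type} [DecidableEq n] [Fintype n] [Field K]
    (M : Matrix n n K) (hM : Mᵀ = M) (c d : n) :
    det M * G4 M c d = M.adjugate c c * M.adjugate d d - M.adjugate c d ^ 2 := by
  have := transfer (κ := Empty) (fun R _ M _ => det M * G4 M c d - (M.adjugate c c * M.adjugate d d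
    - M.adjugate c d ^ 2)) ?_ ?_ K M Empty.elim hM
  · exact sub_eq_zero.1 this
  · intro R S _ _ f M y
    simp only [map_sub, map_mul, map_pow, map_det', map_adj', map_G4]
  · intro L _ M y hM h0
    rw [G4_inv M hM h0]
    field_simp
    ring

/-- polynomial of the first graph -/
def Q1 {K : Type*} [CommRing K] (g0 g1 g2 g3 g4 : K) (y : Fin 2 ⊕ Fin 4 → K) : K :=
  QQ (QQ g0 g1 g2 g3 g4 (y (Sum.inr 0)) (y (Sum.inr 1)) (y (Sum.inl 0)))
    (y (Sum.inr 0)*y (Sum.inr 1)*(y (Sum.inl 0)*g0+g3))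
    (y (Sum.inr 0)*(y (Sum.inl 0)*(g1+g2)+y (Sum.inr 1)*g1+g4))
    (y (Sum.inr 1)*(y (Sum.inl 0)*(g1+g2)+y (Sum.inr 0)*g2+g4))
    (y (Sum.inr 0)*y (Sum.inr 1)*(y (Sum.inl 0)*(g1+g2)+g4))
    (y (Sum.inl 1)) (y (Sum.inr 2)) (y (Sum.inr 3))

def Q2 {K : Type*} [CommRing K] (g0 g1 g2 g3 g4 : K) (y : Fin 1 ⊕ Fin 3 → K) : K :=
  QQ (y (Sum.inr 2)*g0 + g1 + g2) (y (Sum.inr 2) * g1) (y (Sum.inr 2) * g2)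
    (y (Sum.inr 2) * g3 + g4)
    (y (Sum.inr 2) * g4) (y (Sum.inr 0)) (y (Sum.inr 1)) (y (Sum.inl 0))

theorem comp_elim0 {R S l k : Type*} [CommRing R] [CommRing S] (f : R →+* S) (v : k → R) :
    f ∘ (Sum.elim (0 : l → R) v) = Sum.elim (0 : l → S) (f ∘ v) := by
  ext i; rcases i with i | i <;> simp

theorem S8_map {R S : Type*} [CommRing R] [CommRing S] (f : R →+* S) (y : Fin 2 ⊕ Fin 4 → R) :
    (S8 y).map f = S8 (f ∘ y) := by
  rw [S8, fromBlocks_map, fromBlocks_map, S8]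
  congr 1
  · congr 1
    · ext i j; simp
    · ext i j; fin_cases i <;> fin_cases j <;> simp
    · ext i j; fin_cases i <;> fin_cases j <;> simp
    · rw [diagonal_map (map_zero f)]; rfl
  · ext i j; rcases i with i | i <;> fin_cases i <;> fin_cases j <;> simp
  · ext j i; rcases i with i | i <;> fin_cases i <;> fin_cases j <;> simp
  · rw [diagonal_map (map_zero f)]; rfl

theorem S5_map {R S : Type*} [CommRing R] [CommRing S] (f : R →+* S) (y : Fin 1 ⊕ Fin 3 → R) :
    (S5 y).map f = S5 (f ∘ y) := by
  rw [S5, fromBlocks_map, fromBlocks_map, S5]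
  congr 1
  · congr 1
    · ext i j; simp
    · ext i j; fin_cases i <;> fin_cases j <;> simp
    · ext i j; fin_cases i <;> fin_cases j <;> simp
    · rw [diagonal_map (map_zero f)]; rfl
  · ext i j; rcases i with i | i <;> fin_cases i <;> fin_cases j <;> simp
  · ext j i; rcases i with i | i <;> fin_cases i <;> fin_cases j <;> simp
  · rw [diagonal_map (map_zero f)]; rfl

theorem bord8 {n K : Type} [DecidableEq n] [Fintype n] [Field K]
    (M : Matrix n n K) (hM : Mᵀ = M) (c d : n) (y : Fin 2 ⊕ Fin 4 → K) :
    det (bord M c d c8 d8 (S8 y)) = Q1 (det M) (M.adjugate c d - M.adjugate c c)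
      (M.adjugate c d - M.adjugate d d) (-M.adjugate c d) (G4 M c d) y := by
  have := transfer (κ := Fin 2 ⊕ Fin 4) (fun R _ M y => det (bord M c d c8 d8 (S8 y)) -
    Q1 (det M) (M.adjugate c d - M.adjugate c c)
      (M.adjugate c d - M.adjugate d d) (-M.adjugate c d) (G4 M c d) y) ?_ ?_ K M y hM
  · exact sub_eq_zero.1 this
  · intro R S _ _ f M y
    have h1 : f ∘ (c8 : _ → R) = c8 := by
      rw [c8, comp_elim0, c8]; congr 1; ext i; fin_cases i <;> simp
    have h2 : f ∘ (d8 : _ → R) = d8 := by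
      rw [d8, comp_elim0, d8]; congr 1; ext i; fin_cases i <;> simp
    simp only [map_sub, map_mul, map_pow, map_det', map_adj', map_G4, bord_map, Q1, QQ, map_add,
      map_neg, S8_map, h1, h2, Function.comp]
  · intro L _ M y hM h0
    rw [bord_det M hM h0, det8, G4_inv M hM h0, sub_eq_zero]
    have e1 : M.adjugate c c = det M * (M.adjugate c c / det M) := by field_simp
    have e2 : M.adjugate d d = det M * (M.adjugate d d / det M) := by field_simp
    have e3 : M.adjugate c d = det M * (M.adjugate c d / det M) := by field_simp
    generalize M.adjugate c c / det M = α at *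
    generalize M.adjugate d d / det M = β at *
    generalize M.adjugate c d / det M = γ at *
    rw [e1, e2, e3]
    simp only [Q1, QQ]
    ring

theorem bord5 {n K : Type} [DecidableEq n] [Fintype n] [Field K]
    (M : Matrix n n K) (hM : Mᵀ = M) (c d : n) (y : Fin 1 ⊕ Fin 3 → K) :
    det (bord M c d c5 d5 (S5 y)) = - Q2 (det M) (M.adjugate c d - M.adjugate c c)
      (M.adjugate c d - M.adjugate d d) (-M.adjugate c d) (G4 M c d) y := by
  have := transfer (κ := Fin 1 ⊕ Fin 3) (fun R _ M y => det (bord M c d c5 d5 (S5 y)) -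
    - Q2 (det M) (M.adjugate c d - M.adjugate c c)
      (M.adjugate c d - M.adjugate d d) (-M.adjugate c d) (G4 M c d) y) ?_ ?_ K M y hM
  · exact sub_eq_zero.1 this
  · intro R S _ _ f M y
    have h1 : f ∘ (c5 : _ → R) = c5 := by
      rw [c5, comp_elim0, c5]; congr 1; ext i; fin_cases i <;> simp
    have h2 : f ∘ (d5 : _ → R) = d5 := by
      rw [d5, comp_elim0, d5]; congr 1; ext i; fin_cases i <;> simp
    simp only [map_sub, map_mul, map_pow, map_det', map_adj', map_G4, bord_map, Q2, QQ, map_add,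
      map_neg, S5_map, h1, h2, Function.comp]
  · intro L _ M y hM h0
    rw [bord_det M hM h0, det5, G4_inv M hM h0, sub_eq_zero]
    have e1 : M.adjugate c c = det M * (M.adjugate c c / det M) := by field_simp
    have e2 : M.adjugate d d = det M * (M.adjugate d d / det M) := by field_simp
    have e3 : M.adjugate c d = det M * (M.adjugate c d / det M) := by field_simp
    generalize M.adjugate c c / det M = α at *
    generalize M.adjugate d d / det M = β at *
    generalize M.adjugate c d / det M = γ at *
    rw [e1, e2, e3]
    simp only [Q2, QQ]
    ring

section partC
variable {K : Type} [Field K] [Fintype K]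

theorem q_cast : ((Fintype.card K : ℕ) : ZMod (Fintype.card K)) = 0 := by simp

theorem card_pos_dim {X : Type*} [AddCommGroup X] [Module K X] [Module.Finite K X]
    (h : 0 < Module.finrank K X) : ((Nat.card X : ℕ) : ZMod (Fintype.card K)) = 0 := by
  rw [Module.natCard_eq_pow_finrank (K := K), Nat.card_eq_fintype_card]
  push_cast
  rw [CharP.cast_eq_zero, zero_pow h.ne']

theorem ker_count {n : Type*} [Fintype n] [DecidableEq n] (A : Matrix n n K) :
    ((Nat.card {z : n → K // A *ᵥ z = 0} : ℕ) : ZMod (Fintype.card K)) =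
      if det A ≠ 0 then 1 else 0 := by
  split_ifs with h
  · have : ∀ z : {z : n → K // A *ᵥ z = 0}, z = ⟨0, by simp⟩ := by
      rintro ⟨z, hz⟩
      exact Subtype.ext (eq_zero_of_mulVec_eq_zero h hz)
    have : Nat.card {z : n → K // A *ᵥ z = 0} = 1 := by
      rw [Nat.card_eq_one_iff_unique]
      exact ⟨⟨fun a b => (this a).trans (this b).symm⟩, ⟨⟨0, by simp⟩⟩⟩
    rw [this]; simp
  · push Not at h
    obtain ⟨v, hv, hv0⟩ := exists_mulVec_eq_zero_iff.2 h
    have : Nat.card {z : n → K // A *ᵥ z = 0} = Nat.card (LinearMap.ker A.mulVecLin) :=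
      Nat.card_congr (Equiv.subtypeEquivRight (by simp))
    rw [this]
    apply card_pos_dim
    rw [Module.finrank_pos_iff]
    refine ⟨⟨⟨v, by simpa using hv0⟩, 0, ?_⟩⟩
    intro h
    exact hv (congrArg Subtype.val h)

theorem fib_count {X P Y T : Type} [AddCommGroup X] [Module K X] [Fintype X] 
    [AddCommGroup Y] [Module K Y] [Fintype Y] [AddCommGroup T] [Module K T] [Module.Finite K T]
    [Fintype P] (C : P → Prop) (L : P → X × Y →ₗ[K] T)
    (h : Module.finrank K T < Module.finrank K X + Module.finrank K Y) :
    ∑ x : X, ((Nat.card {p : P × Y // C p.1 ∧ L p.1 (x, p.2) = 0} : ℕ) : ZMod (Fintype.card K))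
      = 0 := by
  rw [← Nat.cast_sum]
  have h1 : ∑ x : X, Nat.card {p : P × Y // C p.1 ∧ L p.1 (x, p.2) = 0} =
      ∑ p : P, Nat.card {z : X × Y // C p ∧ L p z = 0} := by
    rw [← Nat.card_sigma, ← Nat.card_sigma]
    exact Nat.card_congr
      { toFun := fun a => ⟨a.2.1.1, ⟨(a.1, a.2.1.2), a.2.2⟩⟩
        invFun := fun a => ⟨a.2.1.1, ⟨(a.1, a.2.1.2), a.2.2⟩⟩
        left_inv := fun _ => rfl
        right_inv := fun _ => rfl }
  rw [h1, Nat.cast_sum]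
  refine Finset.sum_eq_zero fun p _ => ?_
  by_cases hC : C p
  · have : Nat.card {z : X × Y // C p ∧ L p z = 0} = Nat.card (LinearMap.ker (L p)) :=
      Nat.card_congr (Equiv.subtypeEquivRight (by simp [hC]))
    rw [this]
    apply card_pos_dim
    haveI : Module.Finite K X := Module.Finite.of_finite
    haveI : Module.Finite K Y := Module.Finite.of_finite
    have h2 := LinearMap.finrank_range_add_finrank_ker (L p)
    have h3 := Submodule.finrank_le (LinearMap.range (L p))
    rw [Module.finrank_prod] at h2
    omega
  · have : IsEmpty {z : X × Y // C p ∧ L p z = 0} := ⟨fun z => hC z.2.1⟩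
    simp

variable {E V : Type} [Fintype E] [Fintype V] [DecidableEq E] [DecidableEq V]

/-- the basic matrix -/
def MM (B : Matrix E V K) (x : E → K) : Matrix (E ⊕ V) (E ⊕ V) K :=
  fromBlocks (diagonal x) B Bᵀ 0

def MB (B : Matrix E V K) (u w : V → K) (x : E → K) :
    Matrix ((E ⊕ V) ⊕ Unit) ((E ⊕ V) ⊕ Unit) K :=
  fromBlocks (MM B x) (replicateCol Unit (Sum.elim 0 w)) (replicateRow Unit (Sum.elim 0 u)) 0

theorem ker_MM (B : Matrix E V K) (x : E → K) :
    ((Nat.card {p : (E → K) × (V → K) // Bᵀ *ᵥ p.1 = 0 ∧ x * p.1 + B *ᵥ p.2 = 0} : ℕ) :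
      ZMod (Fintype.card K)) = if det (MM B x) ≠ 0 then 1 else 0 := by
  rw [← ker_count]
  congr 1
  refine Nat.card_congr (Equiv.subtypeEquiv (Equiv.sumArrowEquivProdArrow E V K).symm ?_)
  rintro ⟨i, φ⟩
  have : (Equiv.sumArrowEquivProdArrow E V K).symm (i, φ) = Sum.elim i φ := rfl
  rw [this, MM, fromBlocks_mulVec]
  simp only [Sum.elim_comp_inl, Sum.elim_comp_inr, zero_mulVec, add_zero]
  have hd : diagonal x *ᵥ i = x * i := by
    ext e; simp [mulVec_diagonal]
  rw [hd]
  constructor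
  · rintro ⟨h1, h2⟩
    rw [h1, h2]; ext k; rcases k with k | k <;> simp
  · intro h
    exact ⟨funext fun k => congrFun h (Sum.inr k), funext fun k => congrFun h (Sum.inl k)⟩

theorem ker_MB (B : Matrix E V K) (u w : V → K) (x : E → K) :
    ((Nat.card {p : ((E → K) × K) × (V → K) // Bᵀ *ᵥ p.1.1 + p.1.2 • w = 0 ∧
      (x * p.1.1 + B *ᵥ p.2 = 0 ∧ u ⬝ᵥ p.2 = 0)} : ℕ) :
      ZMod (Fintype.card K)) = if det (MB B u w x) ≠ 0 then 1 else 0 := by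
  rw [← ker_count]
  congr 1
  let e : ((E → K) × K) × (V → K) ≃ (((E ⊕ V) ⊕ Unit) → K) :=
    { toFun := fun p => Sum.elim (Sum.elim p.1.1 p.2) (fun _ => p.1.2)
      invFun := fun z => ((fun e => z (Sum.inl (Sum.inl e)), z (Sum.inr ())),
        fun v => z (Sum.inl (Sum.inr v)))
      left_inv := fun _ => rfl
      right_inv := fun z => by ext k; rcases k with (k | k) | k <;> rfl }
  refine Nat.card_congr (Equiv.subtypeEquiv e ?_)
  rintro ⟨⟨i, l⟩, φ⟩
  have : e ((i, l), φ) = Sum.elim (Sum.elim i φ) (fun _ => l) := rfl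
  rw [this, MB, fromBlocks_mulVec, MM]
  simp only [Sum.elim_comp_inl, Sum.elim_comp_inr]
  rw [fromBlocks_mulVec]
  simp only [Sum.elim_comp_inl, Sum.elim_comp_inr, zero_mulVec, add_zero]
  have hd : diagonal x *ᵥ i = x * i := by
    ext e; simp [mulVec_diagonal]
  rw [hd]
  have key : ∀ (a : E → K) (b : V → K),
      (Sum.elim (Sum.elim a b + replicateCol Unit (Sum.elim 0 w) *ᵥ (fun _ => l))
        (replicateRow Unit (Sum.elim 0 u) *ᵥ Sum.elim i φ) : (E ⊕ V) ⊕ Unit → K) =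
      Sum.elim (Sum.elim a (b + l • w)) (fun _ => u ⬝ᵥ φ) := by
    intro a b
    ext k
    rcases k with (k | k) | k <;>
      simp [mulVec, dotProduct, mul_comm]
  rw [key]
  constructor
  · rintro ⟨h1, h2, h3⟩
    rw [h1, h2, h3]; ext k; rcases k with (k | k) | k <;> simp
  · intro h
    exact ⟨funext fun k => congrFun h (Sum.inl (Sum.inr k)),
      funext fun k => congrFun h (Sum.inl (Sum.inl k)), congrFun h (Sum.inr ())⟩

theorem sum_MM (B : Matrix E V K) (hV : 0 < Fintype.card V) :
    ∑ x : E → K, (if det (MM B x) ≠ 0 then 1 else 0 : ZMod (Fintype.card K)) = 0 := by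
  simp only [← ker_MM]
  refine fib_count (P := E → K) (fun i => Bᵀ *ᵥ i = 0)
    (fun i => { toFun := fun z => z.1 * i + B *ᵥ z.2
                map_add' := fun a b => by simp [add_mul, mulVec_add]; abel
                map_smul' := fun a b => by simp [mulVec_smul] } :
      (E → K) → (E → K) × (V → K) →ₗ[K] (E → K)) ?_
  simpa using hV

theorem sum_MB (B : Matrix E V K) (u w : V → K) (hV : 1 < Fintype.card V) :
    ∑ x : E → K, (if det (MB B u w x) ≠ 0 then 1 else 0 : ZMod (Fintype.card K)) = 0 := by
  simp only [← ker_MB]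
  have := fib_count (K := K) (P := (E → K) × K) (fun i => Bᵀ *ᵥ i.1 + i.2 • w = 0)
    (fun i => { toFun := fun z => (z.1 * i.1 + B *ᵥ z.2, u ⬝ᵥ z.2)
                map_add' := fun a b => by
                  ext <;> simp [add_mul, mulVec_add, dotProduct_add]; ring
                map_smul' := fun a b => by ext <;> simp [mulVec_smul, mul_add, mul_assoc] } :
      (E → K) × K → (E → K) × (V → K) →ₗ[K] ((E → K) × K)) (by simpa using hV)
  simpa using this

theorem sum_MMMB (B : Matrix E V K) (u w : V → K)
    (hV : Fintype.card E + 1 < 2 * Fintype.card V) :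
    ∑ x : E → K, ((if det (MM B x) ≠ 0 then 1 else 0) * (if det (MB B u w x) ≠ 0 then 1 else 0) :
      ZMod (Fintype.card K)) = 0 := by
  simp only [← ker_MB, ← ker_MM, ← Nat.cast_mul, ← Nat.card_prod]
  have := fib_count (K := K) (P := (E → K) × ((E → K) × K))
    (fun i => Bᵀ *ᵥ i.1 = 0 ∧ Bᵀ *ᵥ i.2.1 + i.2.2 • w = 0)
    (fun i => { toFun := fun z => (z.1 * i.1 + B *ᵥ z.2.1, (z.1 * i.2.1 + B *ᵥ z.2.2, u ⬝ᵥ z.2.2))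
                map_add' := fun a b => by
                  ext <;> simp [add_mul, mulVec_add, dotProduct_add] <;> ring
                map_smul' := fun a b => by ext <;> simp [mulVec_smul, mul_add, mul_assoc] } :
      (E → K) × ((E → K) × K) → (E → K) × ((V → K) × (V → K)) →ₗ[K] ((E → K) × ((E → K) × K)))
      (by simp; omega)
  refine Eq.trans (Finset.sum_congr rfl fun x _ => ?_) this
  congr 1
  refine Nat.card_congr
    { toFun := fun a => ⟨((a.1.1.1, a.2.1.1), (a.1.1.2, a.2.1.2)), ?_⟩
      invFun := fun a => (⟨(a.1.1.1, a.1.2.1), ?_⟩, ⟨(a.1.1.2, a.1.2.2), ?_⟩)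
      left_inv := fun _ => rfl
      right_inv := fun _ => rfl }
  · obtain ⟨⟨a, h1, h2⟩, ⟨b, h3, h4⟩⟩ := a
    exact ⟨⟨h1, h3⟩, by simp [h2, h4]⟩
  · obtain ⟨a, h1, h2⟩ := a
    simp at h2
    exact ⟨h1.1, h2.1⟩
  · obtain ⟨a, h1, h2⟩ := a
    simp at h2
    exact ⟨h1.2, h2.2⟩

theorem MB_det {n K : Type} [DecidableEq n] [Fintype n] [Field K]
    (M : Matrix n n K) (hM : Mᵀ = M) (u w : n → K) :
    det (fromBlocks M (replicateCol Unit w) (replicateRow Unit u) 0) =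
      - (u ⬝ᵥ M.adjugate *ᵥ w) := by
  have := transfer (κ := n ⊕ n) (fun R _ M y => det (fromBlocks M
    (replicateCol Unit (fun i => y (Sum.inr i))) (replicateRow Unit (fun i => y (Sum.inl i))) 0) +
      ∑ i, y (Sum.inl i) * ∑ j, M.adjugate i j * y (Sum.inr j)) ?_ ?_ K M (Sum.elim u w) hM
  · exact eq_neg_of_add_eq_zero_left this
  · intro R S _ _ f M y
    simp only [map_add, map_det', map_sum, map_mul, map_adj', Function.comp, fromBlocks_map]
    congr 3
    ext i j; simp
  · intro L _ M y hM h0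
    letI : Invertible M := invertibleOfIsUnitDet M (isUnit_iff_ne_zero.2 h0)
    rw [det_fromBlocks₁₁, invOf_eq_nonsing_inv, inv_def, Ring.inverse_eq_inv']
    simp only [det_unique, Matrix.neg_apply, Matrix.sub_apply, Matrix.zero_apply, zero_sub, Matrix.mul_smul,
      Matrix.smul_mul, Matrix.smul_apply, smul_eq_mul, mul_neg]
    rw [mul_inv_cancel_left₀ h0, Matrix.mul_assoc]
    simp only [mul_apply, replicateCol_apply, replicateRow_apply]
    exact neg_add_cancel _
end partC

section partD
variable {K : Type} [Field K] [Fintype K]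

theorem lin_count {R : Type*} [CommRing R] (a b : K) :
    ∑ t : K, (if a * t + b = 0 then 1 else 0 : R) =
      if a ≠ 0 then 1 else if b = 0 then (Fintype.card K : R) else 0 := by
  by_cases ha : a = 0
  · subst ha
    by_cases hb : b = 0 <;> simp [hb]
  · rw [if_pos ha]
    have : ∀ t, (a * t + b = 0) ↔ t = -b / a := by
      intro t
      rw [eq_div_iff ha, add_eq_zero_iff_eq_neg, mul_comm]
    simp [this]

theorem quad_count :
    ∑ a : K, ∑ b : K, ∑ c : K, (if a*b+a*c+b*c = 0 then 1 else 0 : ℤ) =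
      (Fintype.card K : ℤ)^2 := by
  have h : ∀ a b : K, ∑ c : K, (if a*b+a*c+b*c = 0 then 1 else 0 : ℤ) =
      1 + (if b = -a then (if a = 0 then (Fintype.card K : ℤ) - 1 else - 1) else 0) := by
    intro a b
    have : ∀ c, a*b+a*c+b*c = (a+b)*c + a*b := fun c => by ring
    simp only [this, lin_count]
    by_cases hb : b = -a
    · subst hb
      by_cases ha : a = 0 <;> simp [ha]
    · have : a + b ≠ 0 := fun h => hb (eq_neg_of_add_eq_zero_right h)
      simp [hb, this]
  simp only [h, Finset.sum_add_distrib, Finset.sum_ite_eq', Finset.mem_univ, if_true]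
  have h2 : ∀ a : K, (if a = 0 then (Fintype.card K : ℤ) - 1 else -1) =
     (if a = 0 then (Fintype.card K : ℤ) else 0) - 1 := by
    intro a; split_ifs <;> ring
  simp only [h2, Finset.sum_sub_distrib, Finset.sum_ite_eq', Finset.mem_univ, if_true]
  simp
  ring

theorem star_count (f0 f1 f2 f3 f4 : K) (h : f0 * f4 = f1*f2+f1*f3+f2*f3) :
    ∑ a : K, ∑ b : K, ∑ c : K, (if QQ f0 f1 f2 f3 f4 a b c = 0 then 1 else 0 : ℤ) =
      (Fintype.card K : ℤ)^2 + (if f0 = 0 ∧ f1 = 0 ∧ f2 = 0 ∧ f3 = 0 then 1 else 0) *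
        ((if f4 = 0 then (Fintype.card K : ℤ) ^ 3 else 0) - (Fintype.card K : ℤ)^2) := by
  by_cases h0 : f0 = 0
  · subst h0
    have hQ : ∀ a b c, QQ 0 f1 f2 f3 f4 a b c = a*(f2+f3)+b*(f1+f3)+c*(f1+f2)+f4 := by
      intro a b c; simp [QQ]
    simp only [hQ]
    by_cases h3 : f1 + f2 = 0
    · have e2 : f2 = - f1 := eq_neg_of_add_eq_zero_right h3
      have e1 : f1 = 0 := by
        subst e2
        have : f1 ^ 2 = 0 := by linear_combination h
        simpa using this
      have e2' : f2 = 0 := by rw [e2, e1, neg_zero]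
      clear e2
      subst e1 e2'
      by_cases e3 : f3 = 0
      · subst e3
        simp
        by_cases h4 : f4 = 0 <;> simp [h4]
        ring
      · simp [e3]
        have : ∀ a b : K, a * f3 + b * f3 + f4 = f3 * b + (a * f3 + f4) := fun a b => by ring
        have h5 : ∀ a b : K, (if a * f3 + b * f3 + f4 = 0 then (Fintype.card K : ℤ) else 0) =
            (if f3 * b + (a * f3 + f4) = 0 then 1 else 0 : ℤ) * (Fintype.card K : ℤ) := by
          intro a b; rw [this, ite_mul, one_mul, zero_mul]
        simp only [h5, ← Finset.sum_mul, lin_count, ne_eq, e3, not_false_eq_true, if_true]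
        simp
        ring
    · have : ∀ a b c : K, a*(f2+f3)+b*(f1+f3)+c*(f1+f2)+f4 =
        (f1+f2) * c + (a*(f2+f3)+b*(f1+f3)+f4) := fun a b c => by ring
      simp only [this, lin_count]
      have hn : ¬ (f1 = 0 ∧ f2 = 0 ∧ f3 = 0) := by
        rintro ⟨rfl, rfl, -⟩; simp at h3
      simp [h3, hn]
      ring
  · have hn : ¬ (f0 = 0 ∧ f1 = 0 ∧ f2 = 0 ∧ f3 = 0) := fun h => h0 h.1
    rw [if_neg hn, zero_mul, add_zero, ← quad_count]
    have hb : ∀ g : K, Function.Bijective (fun a : K => f0 * a + g) := by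
      intro g
      refine ⟨fun a b hab => ?_, fun b => ⟨(b - g) / f0, ?_⟩⟩
      · simpa [h0] using hab
      · field_simp; ring
    refine Fintype.sum_bijective _ (hb f1) _ _ fun a => ?_
    refine Fintype.sum_bijective _ (hb f2) _ _ fun b => ?_
    refine Fintype.sum_bijective _ (hb f3) _ _ fun c => ?_
    have : (f0*a+f1)*(f0*b+f2)+(f0*a+f1)*(f0*c+f3)+(f0*b+f2)*(f0*c+f3) =
      f0 * QQ f0 f1 f2 f3 f4 a b c := by
      simp only [QQ]; linear_combination (-1) * h
    rw [this]
    simp [h0]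

/-- indicator -/
noncomputable def ind (R : Type*) [CommRing R] (P : Prop) : R := if P then 1 else 0

noncomputable def n1 (g0 g1 g2 g3 g4 : K) : ZMod (Fintype.card K) :=
  ∑ p : K, ∑ r : K, ∑ s : K, ind _ (QQ g0 g1 g2 g3 g4 p r s = 0 ∧ p*r*(s*g0+g3) = 0 ∧
    p*(s*(g1+g2)+r*g1+g4) = 0 ∧ r*(s*(g1+g2)+p*g2+g4) = 0)

noncomputable def n2 (g0 g1 g2 g3 g4 : K) : ZMod (Fintype.card K) :=
  ∑ e : K, ind _ (e*g0+g1+g2 = 0 ∧ e*g1 = 0 ∧ e*g2 = 0 ∧ e*g3+g4 = 0)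

theorem lin_countR (a b : K) :
    ∑ t : K, (if t * a + b = 0 then 1 else 0 : ZMod (Fintype.card K)) = if a ≠ 0 then 1 else 0 := by
  have := lin_count (R := ZMod (Fintype.card K)) a b
  simp only [mul_comm a] at this
  rw [this]; simp

theorem sum_nz (f : ZMod (Fintype.card K)) :
    ∑ t ∈ (Finset.univ.erase (0 : K)), f = - f := by
  have := Finset.sum_erase_add (Finset.univ : Finset K) (fun _ => f) (Finset.mem_univ 0)
  rw [eq_neg_iff_add_eq_zero, this]
  simp

theorem sum_split {R : Type*} [CommRing R] (f : K → R) :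
    ∑ t, f t = f 0 + ∑ t ∈ (Finset.univ.erase (0 : K)), f t :=
  (Finset.add_sum_erase _ _ (Finset.mem_univ _)).symm

theorem half_count (g0 g1 g2 g3 g4 : K) (h : g0 * g4 = g1*g2+g1*g3+g2*g3) :
    ∑ s : K, (if s*(g1+g2)+g4 = 0 ∧ s*g0+(g1+g3) = 0 then 1 else 0 : ZMod (Fintype.card K)) =
    if g0 ≠ 0 then (if g1 = 0 then 1 else 0) else
      if g1 = 0 ∧ g3 = 0 ∧ g2 ≠ 0 then 1 else 0 := by
  by_cases h0 : g0 = 0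
  · subst h0
    simp only [ne_eq, not_true_eq_false, if_false]
    by_cases h13 : g1 + g3 = 0
    · have e3 : g3 = -g1 := eq_neg_of_add_eq_zero_right h13
      have e1 : g1 = 0 := by
        subst e3
        have : g1 ^ 2 = 0 := by linear_combination h
        simpa using this
      have e3' : g3 = 0 := by rw [e3, e1, neg_zero]
      clear e3
      subst e1 e3'
      simpa using lin_countR g2 g4
    · have : ¬ (g1 = 0 ∧ g3 = 0 ∧ g2 ≠ 0) := by
        rintro ⟨rfl, rfl, -⟩; simp at h13
      simp [h13, this]
  · rw [if_pos h0]
    have : ∀ s, (s*(g1+g2)+g4 = 0 ∧ s*g0+(g1+g3) = 0) ↔ (g1 = 0 ∧ s = -(g1+g3)/g0) := by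
      intro s
      rw [eq_div_iff h0, ← add_eq_zero_iff_eq_neg]
      constructor
      · rintro ⟨h1, h2⟩
        refine ⟨?_, h2⟩
        have : g1^2 = 0 := by linear_combination (g1+g2)*h2 - g0*h1 + h
        simpa using this
      · rintro ⟨rfl, h2⟩
        refine ⟨?_, h2⟩
        have : g0 * (s*(0+g2)+g4) = 0 := by linear_combination g2*h2 + h
        simpa [h0] using this
    simp only [this]
    by_cases h1 : g1 = 0 <;> simp [h1]

theorem n1_eq (g0 g1 g2 g3 g4 : K) (h : g0 * g4 = g1*g2+g1*g3+g2*g3) :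
    n1 g0 g1 g2 g3 g4 = (if g1 + g2 ≠ 0 then 1 else 0)
      - (if g0 ≠ 0 then (if g1 = 0 then 1 else 0) else
      if g1 = 0 ∧ g3 = 0 ∧ g2 ≠ 0 then 1 else 0)
      - (if g0 ≠ 0 then (if g2 = 0 then 1 else 0) else
      if g2 = 0 ∧ g3 = 0 ∧ g1 ≠ 0 then 1 else 0)
      + (if g0 ≠ 0 ∧ g1 ≠ 0 ∧ g2 ≠ 0 then 1 else 0) := by
  rw [n1, sum_split, sum_split]
  have c00 : ∑ s : K, ind (ZMod (Fintype.card K)) (QQ g0 g1 g2 g3 g4 0 0 s = 0 ∧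
      0*0*(s*g0+g3) = 0 ∧
    0*(s*(g1+g2)+0*g1+g4) = 0 ∧ 0*(s*(g1+g2)+0*g2+g4) = 0) = if g1 + g2 ≠ 0 then 1 else 0 := by
    simp only [QQ, ind]
    simp
    simpa using lin_countR (g1+g2) g4
  have c0r : ∀ r ∈ Finset.univ.erase (0:K), ∑ s : K, ind (ZMod (Fintype.card K))
      (QQ g0 g1 g2 g3 g4 0 r s = 0 ∧
      0*r*(s*g0+g3) = 0 ∧
    0*(s*(g1+g2)+r*g1+g4) = 0 ∧ r*(s*(g1+g2)+0*g2+g4) = 0) = 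
    if g0 ≠ 0 then (if g1 = 0 then 1 else 0) else
      if g1 = 0 ∧ g3 = 0 ∧ g2 ≠ 0 then 1 else 0 := by
    intro r hr
    have hr : r ≠ 0 := by simpa using hr
    rw [← half_count g0 g1 g2 g3 g4 h]
    refine Finset.sum_congr rfl fun s _ => ?_
    rw [ind]
    congr 1
    apply propext
    simp only [QQ]
    constructor
    · rintro ⟨h1, -, -, h4⟩
      have h4 : s*(g1+g2)+0*g2+g4 = 0 := by simpa [hr] using h4
      refine ⟨by linear_combination h4, ?_⟩
      have : r * (s*g0+(g1+g3)) = 0 := by linear_combination h1 - h4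
      simpa [hr] using this
    · rintro ⟨h1, h2⟩
      refine ⟨by linear_combination h1 + r*h2, by ring, by ring, by linear_combination r * h1⟩
  have cp0 : ∀ p ∈ Finset.univ.erase (0:K), ∑ s : K, ind (ZMod (Fintype.card K))
      (QQ g0 g1 g2 g3 g4 p 0 s = 0 ∧
      p*0*(s*g0+g3) = 0 ∧
    p*(s*(g1+g2)+0*g1+g4) = 0 ∧ 0*(s*(g1+g2)+p*g2+g4) = 0) = 
    if g0 ≠ 0 then (if g2 = 0 then 1 else 0) else
      if g2 = 0 ∧ g3 = 0 ∧ g1 ≠ 0 then 1 else 0 := by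
    intro r hr
    have hr : r ≠ 0 := by simpa using hr
    rw [← half_count g0 g2 g1 g3 g4 (by linear_combination h)]
    refine Finset.sum_congr rfl fun s _ => ?_
    rw [ind]
    congr 1
    apply propext
    simp only [QQ]
    constructor
    · rintro ⟨h1, -, h4, -⟩
      have h4 : s*(g1+g2)+0*g1+g4 = 0 := by simpa [hr] using h4
      refine ⟨by linear_combination h4, ?_⟩
      have : r * (s*g0+(g2+g3)) = 0 := by linear_combination h1 - h4
      simpa [hr] using this
    · rintro ⟨h1, h2⟩
      refine ⟨by linear_combination h1 + r*h2, by ring, by linear_combination r * h1, by ring⟩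
  have cpr : ∑ p ∈ Finset.univ.erase (0:K), ∑ r ∈ Finset.univ.erase (0:K), ∑ s : K,
     ind (ZMod (Fintype.card K)) (QQ g0 g1 g2 g3 g4 p r s = 0 ∧ p*r*(s*g0+g3) = 0 ∧
    p*(s*(g1+g2)+r*g1+g4) = 0 ∧ r*(s*(g1+g2)+p*g2+g4) = 0) = 
    if g0 ≠ 0 ∧ g1 ≠ 0 ∧ g2 ≠ 0 then 1 else 0 := by
    have key : ∀ p ∈ Finset.univ.erase (0:K), ∀ r ∈ Finset.univ.erase (0:K), ∀ s : K,
      (QQ g0 g1 g2 g3 g4 p r s = 0 ∧ p*r*(s*g0+g3) = 0 ∧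
    p*(s*(g1+g2)+r*g1+g4) = 0 ∧ r*(s*(g1+g2)+p*g2+g4) = 0) ↔
      (s*g0+g3 = 0 ∧ r*g0+g2 = 0 ∧ p*g0+g1=0 ∧ s*(g1+g2)+r*g1+g4=0) := by
      intro p hp r hr s
      have hp : p ≠ 0 := by simpa using hp
      have hr : r ≠ 0 := by simpa using hr
      constructor
      · rintro ⟨h1, h2, h3, h4⟩
        have h2 : s*g0+g3 = 0 := by simpa [hp, hr] using h2
        have h3 : s*(g1+g2)+r*g1+g4 = 0 := by simpa [hp] using h3
        have h4 : s*(g1+g2)+p*g2+g4 = 0 := by simpa [hr] using h4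
        simp only [QQ] at h1
        have h5 : p * (r*g0+g2) = 0 := by linear_combination h1 - (p+r)*h2 - h3
        have h6 : r * (p*g0+g1) = 0 := by linear_combination h1 - (p+r)*h2 - h4
        refine ⟨h2, ?_, ?_, h3⟩
        · simpa [hp] using h5
        · simpa [hr] using h6
      · rintro ⟨h2, h5, h6, h3⟩
        have h4 : s*(g1+g2)+p*g2+g4 = 0 := by linear_combination h3 + p*h5 - r*h6
        simp only [QQ]
        refine ⟨by linear_combination (p+r)*h2+h3+p*h5, by rw [h2]; ring, by rw [h3]; ring,
          by rw [h4]; ring⟩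
    have e1 : ∑ p ∈ Finset.univ.erase (0:K), ∑ r ∈ Finset.univ.erase (0:K), ∑ s : K,
     ind (ZMod (Fintype.card K)) (QQ g0 g1 g2 g3 g4 p r s = 0 ∧ p*r*(s*g0+g3) = 0 ∧
    p*(s*(g1+g2)+r*g1+g4) = 0 ∧ r*(s*(g1+g2)+p*g2+g4) = 0) =
      ∑ p ∈ Finset.univ.erase (0:K), ∑ r ∈ Finset.univ.erase (0:K), ∑ s : K,
     ind (ZMod (Fintype.card K)) (s*g0+g3 = 0 ∧ r*g0+g2 = 0 ∧ p*g0+g1=0 ∧ s*(g1+g2)+r*g1+g4=0) := by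
      refine Finset.sum_congr rfl fun p hp => Finset.sum_congr rfl fun r hr =>
        Finset.sum_congr rfl fun s _ => ?_
      rw [key p hp r hr s]
    rw [e1]
    by_cases h0 : g0 = 0
    · subst h0
      rw [if_neg (by simp)]
      refine Finset.sum_eq_zero fun p _ => Finset.sum_eq_zero fun r _ => ?_
      by_cases hh : g1 = 0 ∧ g2 = 0
      · obtain ⟨rfl, rfl⟩ := hh
        simp [ind]
      · refine Finset.sum_eq_zero fun s _ => ?_
        rw [ind, if_neg]
        rintro ⟨-, h2, h1, -⟩
        exact hh ⟨by simpa using h1, by simpa using h2⟩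
    · have e2 : ∀ p r s : K, ind (ZMod (Fintype.card K))
         (s*g0+g3 = 0 ∧ r*g0+g2 = 0 ∧ p*g0+g1=0 ∧ s*(g1+g2)+r*g1+g4=0) =
         if p = -g1/g0 then (if r = -g2/g0 then (if s = -g3/g0 then 1 else 0) else 0) else 0 := by
        intro p r s
        rw [← ite_and, ← ite_and, ind]
        congr 1
        apply propext
        rw [eq_div_iff h0, eq_div_iff h0, eq_div_iff h0, ← add_eq_zero_iff_eq_neg,
          ← add_eq_zero_iff_eq_neg, ← add_eq_zero_iff_eq_neg]
        constructor
        · rintro ⟨h1, h2, h3, -⟩; exact ⟨⟨h3, h2⟩, h1⟩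
        · rintro ⟨⟨h3, h2⟩, h1⟩
          refine ⟨h1, h2, h3, ?_⟩
          have : g0 * (s*(g1+g2)+r*g1+g4) = 0 := by
            linear_combination (g1+g2)*h1 + g1*h2 + h
          simpa [h0] using this
      simp only [e2]
      by_cases k1 : g1 = 0
      · simp [k1]
      · by_cases k2 : g2 = 0
        · simp [k2]
        · have m1 : -g1/g0 ∈ Finset.univ.erase (0:K) := by simp [k1, h0]
          have m2 : -g2/g0 ∈ Finset.univ.erase (0:K) := by simp [k2, h0]
          rw [Finset.sum_eq_single_of_mem _ m1 (by intro b _ hb; simp [hb]),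
            Finset.sum_eq_single_of_mem _ m2 (by intro b _ hb; simp [hb])]
          simp [k1, k2, h0]
  rw [c00, Finset.sum_congr rfl c0r, sum_nz]
  have e3 : ∀ p ∈ Finset.univ.erase (0:K), ∑ r, ∑ s : K,
     ind (ZMod (Fintype.card K)) (QQ g0 g1 g2 g3 g4 p r s = 0 ∧ p*r*(s*g0+g3) = 0 ∧
    p*(s*(g1+g2)+r*g1+g4) = 0 ∧ r*(s*(g1+g2)+p*g2+g4) = 0) = 
    (if g0 ≠ 0 then (if g2 = 0 then 1 else 0) else
      if g2 = 0 ∧ g3 = 0 ∧ g1 ≠ 0 then 1 else 0) +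
    ∑ r ∈ Finset.univ.erase (0:K), ∑ s : K,
     ind (ZMod (Fintype.card K)) (QQ g0 g1 g2 g3 g4 p r s = 0 ∧ p*r*(s*g0+g3) = 0 ∧
    p*(s*(g1+g2)+r*g1+g4) = 0 ∧ r*(s*(g1+g2)+p*g2+g4) = 0) := by
    intro p hp
    rw [sum_split, cp0 p hp]
  rw [Finset.sum_congr rfl e3, Finset.sum_add_distrib, cpr, sum_nz]
  ring

theorem n2_eq (g0 g1 g2 g3 g4 : K) (h : g0 * g4 = g1*g2+g1*g3+g2*g3) :
    n2 g0 g1 g2 g3 g4 = if g1 = 0 ∧ g2 = 0 ∧ (g0 ≠ 0 ∨ g3 ≠ 0) then 1 else 0 := by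
  rw [n2]
  by_cases hh : g1 = 0 ∧ g2 = 0
  · obtain ⟨rfl, rfl⟩ := hh
    by_cases h0 : g0 = 0
    · subst h0
      simpa [ind] using lin_countR g3 g4
    · have h4 : g4 = 0 := by simpa [h0] using h
      subst h4
      have : ∀ e : K, (e*g0+0+0 = 0 ∧ e*0 = 0 ∧ e*0 = 0 ∧ e*g3+0=0) ↔ e = 0 := by
        intro e
        constructor
        · rintro ⟨h1, -⟩; simpa [h0] using h1
        · rintro rfl; simp
      simp only [ind, this]
      simp [h0]
  · rw [if_neg (fun h => hh ⟨h.1, h.2.1⟩)]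
    refine Finset.sum_eq_zero fun e _ => ?_
    rw [ind, if_neg]
    rintro ⟨h1, h2, h3, h4⟩
    have he : e = 0 := by
      by_contra he
      exact hh ⟨by simpa [he] using h2, by simpa [he] using h3⟩
    subst he
    have e2 : g2 = -g1 := eq_neg_of_add_eq_zero_right (by linear_combination h1)
    have e4 : g4 = 0 := by simpa using h4
    subst e2 e4
    have : g1^2 = 0 := by linear_combination h
    have : g1 = 0 := by simpa using this
    exact hh ⟨this, by simp [this]⟩

/-- the key linear identity -/
theorem n1_sub_n2 (g0 g1 g2 g3 g4 : K) (h : g0 * g4 = g1*g2+g1*g3+g2*g3) :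
    n1 g0 g1 g2 g3 g4 - n2 g0 g1 g2 g3 g4 =
    -3 * (if g0 ≠ 0 then 1 else 0) - (if g1 + g2 ≠ 0 then 1 else 0)
    - 2 * (if g1 + g3 ≠ 0 then 1 else 0) + (if g2 + g3 ≠ 0 then 1 else 0)
    + 3 * (if g1 ≠ 0 then 1 else 0)
    + 2 * ((if g0 ≠ 0 then 1 else 0) * (if g1 + g2 ≠ 0 then 1 else 0))
    + 2 * ((if g0 ≠ 0 then 1 else 0) * (if g1 + g3 ≠ 0 then 1 else 0))
    - (if g0 ≠ 0 then 1 else 0) * (if g2 + g3 ≠ 0 then 1 else 0)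
    - (if g0 ≠ 0 then 1 else 0) * (if g1 ≠ 0 then 1 else 0)
    + 2 * ((if g0 ≠ 0 then 1 else 0) * (if g2 ≠ 0 then 1 else 0)) := by
  rw [n1_eq _ _ _ _ _ h, n2_eq _ _ _ _ _ h]
  by_cases h0 : g0 = 0
  · have a12 : g1 + g2 = 0 ↔ (g1 = 0 ∧ g2 = 0) := by
      constructor
      · intro e
        have e2 : g2 = -g1 := eq_neg_of_add_eq_zero_right e
        have : g1^2 = 0 := by rw [h0, e2] at h; linear_combination h
        have : g1 = 0 := by simpa using this
        exact ⟨this, by simp [e2, this]⟩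
      · rintro ⟨rfl, rfl⟩; simp
    have a13 : g1 + g3 = 0 ↔ (g1 = 0 ∧ g3 = 0) := by
      constructor
      · intro e
        have e2 : g3 = -g1 := eq_neg_of_add_eq_zero_right e
        have : g1^2 = 0 := by rw [h0, e2] at h; linear_combination h
        have : g1 = 0 := by simpa using this
        exact ⟨this, by simp [e2, this]⟩
      · rintro ⟨rfl, rfl⟩; simp
    have a23 : g2 + g3 = 0 ↔ (g2 = 0 ∧ g3 = 0) := by
      constructor
      · intro e
        have e2 : g3 = -g2 := eq_neg_of_add_eq_zero_right e
        have : g2^2 = 0 := by rw [h0, e2] at h; linear_combination h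
        have : g2 = 0 := by simpa using this
        exact ⟨this, by simp [e2, this]⟩
      · rintro ⟨rfl, rfl⟩; simp
    simp only [ne_eq, a12, a13, a23, h0]
    by_cases h1 : g1 = 0 <;> by_cases h2 : g2 = 0 <;> by_cases h3 : g3 = 0 <;>
      simp [h0, h1, h2, h3] at h ⊢ <;> ring
  · by_cases h1 : g1 = 0 <;> by_cases h2 : g2 = 0 <;>
      by_cases h12 : g1 + g2 = 0 <;> by_cases h13 : g1 + g3 = 0 <;> by_cases h23 : g2 + g3 = 0 <;>
      simp [h0, h1, h2, h12, h13, h23] at * <;> first | ring | (exfalso; simp_all)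
end partD

section partD2
variable {K : Type} [Field K] [Fintype K]

def eqv8 : K × K × K × K × K × K ≃ (Fin 2 ⊕ Fin 4 → K) where
  toFun z := Sum.elim ![z.2.2.1, z.2.2.2.1] ![z.1, z.2.1, z.2.2.2.2.1, z.2.2.2.2.2]
  invFun y := (y (Sum.inr 0), y (Sum.inr 1), y (Sum.inl 0), y (Sum.inl 1), y (Sum.inr 2),
    y (Sum.inr 3))
  left_inv z := by simp
  right_inv y := by
    ext i
    rcases i with i | i <;> fin_cases i <;> rfl

def eqv5 : K × K × K × K ≃ (Fin 1 ⊕ Fin 3 → K) where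
  toFun z := Sum.elim ![z.2.2.2] ![z.2.1, z.2.2.1, z.1]
  invFun y := (y (Sum.inr 2), y (Sum.inr 0), y (Sum.inr 1), y (Sum.inl 0))
  left_inv z := by simp
  right_inv y := by
    ext i
    rcases i with i | i <;> fin_cases i <;> rfl

theorem sum8 (f : (Fin 2 ⊕ Fin 4 → K) → ℤ) :
    ∑ y, f y = ∑ p : K, ∑ r : K, ∑ s : K, ∑ y1 : K, ∑ y2 : K, ∑ y3 : K,
      f (Sum.elim ![s, y1] ![p, r, y2, y3]) := by
  rw [← Equiv.sum_comp eqv8]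
  simp only [Fintype.sum_prod_type]
  rfl

theorem sum5 (f : (Fin 1 ⊕ Fin 3 → K) → ℤ) :
    ∑ y, f y = ∑ e : K, ∑ y1 : K, ∑ y2 : K, ∑ y3 : K,
      f (Sum.elim ![y3] ![y1, y2, e]) := by
  rw [← Equiv.sum_comp eqv5]
  simp only [Fintype.sum_prod_type]
  rfl

theorem star_mod (f0 f1 f2 f3 f4 : K) (h : f0 * f4 = f1*f2+f1*f3+f2*f3) :
    (∑ a : K, ∑ b : K, ∑ c : K, (if QQ f0 f1 f2 f3 f4 a b c = 0 then 1 else 0 : ℤ)) ≡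
      (Fintype.card K : ℤ)^2 - (Fintype.card K : ℤ)^2 * ind ℤ (f0 = 0 ∧ f1 = 0 ∧ f2 = 0 ∧ f3 = 0)
      [ZMOD (Fintype.card K : ℤ)^3] := by
  rw [star_count _ _ _ _ _ h, ind]
  refine (Int.modEq_iff_dvd.2 ?_)
  by_cases h1 : f0 = 0 ∧ f1 = 0 ∧ f2 = 0 ∧ f3 = 0
  · by_cases h4 : f4 = 0
    · simp only [h1, h4, if_true, and_self]
      exact ⟨-1, by ring⟩
    · simp only [h1, h4, if_true, if_false, and_self]
      exact ⟨0, by ring⟩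
  · simp only [h1, if_false]
    exact ⟨0, by ring⟩

theorem sum_modEq {ι : Type*} (s : Finset ι) (n : ℤ) (f g : ι → ℤ)
    (h : ∀ i ∈ s, f i ≡ g i [ZMOD n]) : ∑ i ∈ s, f i ≡ ∑ i ∈ s, g i [ZMOD n] := by
  rw [Int.modEq_iff_dvd, ← Finset.sum_sub_distrib]
  exact Finset.dvd_sum fun i hi => Int.modEq_iff_dvd.1 (h i hi)

theorem rel1 (g0 g1 g2 g3 g4 p r s : K) (h : g0 * g4 = g1*g2+g1*g3+g2*g3) :
    QQ g0 g1 g2 g3 g4 p r s * (p*r*(s*(g1+g2)+g4)) =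
    p*r*(s*g0+g3) * (p*(s*(g1+g2)+r*g1+g4)) + p*r*(s*g0+g3) * (r*(s*(g1+g2)+p*g2+g4)) +
    p*(s*(g1+g2)+r*g1+g4) * (r*(s*(g1+g2)+p*g2+g4)) := by
  simp only [QQ]
  linear_combination (p^2*r^2) * h

theorem Q1_elim (g0 g1 g2 g3 g4 p r s y1 y2 y3 : K) :
    Q1 g0 g1 g2 g3 g4 (Sum.elim ![s, y1] ![p, r, y2, y3]) =
    QQ (QQ g0 g1 g2 g3 g4 p r s) (p*r*(s*g0+g3)) (p*(s*(g1+g2)+r*g1+g4)) (r*(s*(g1+g2)+p*g2+g4))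
      (p*r*(s*(g1+g2)+g4)) y1 y2 y3 := by
  simp [Q1]

theorem Q2_elim (g0 g1 g2 g3 g4 e y1 y2 y3 : K) :
    Q2 g0 g1 g2 g3 g4 (Sum.elim ![y3] ![y1, y2, e]) =
    QQ (e*g0+g1+g2) (e*g1) (e*g2) (e*g3+g4) (e*g4) y1 y2 y3 := by
  simp [Q2]

theorem D_final {X : Type} [Fintype X] (g0 g1 g2 g3 g4 : X → K)
    (h : ∀ x, g0 x * g4 x = g1 x * g2 x + g1 x * g3 x + g2 x * g3 x)
    (hs : ∑ x, (n1 (g0 x) (g1 x) (g2 x) (g3 x) (g4 x) - n2 (g0 x) (g1 x) (g2 x) (g3 x) (g4 x)) = 0) :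
    Nat.card {z : X × (Fin 2 ⊕ Fin 4 → K) //
      Q1 (g0 z.1) (g1 z.1) (g2 z.1) (g3 z.1) (g4 z.1) z.2 = 0} ≡
    Nat.card {z : X × (Fin 1 ⊕ Fin 3 → K) //
      Q2 (g0 z.1) (g1 z.1) (g2 z.1) (g3 z.1) (g4 z.1) z.2 = 0} [MOD (Fintype.card K) ^ 3] := by
  rw [← Int.natCast_modEq_iff]
  push_cast
  set q : ℤ := (Fintype.card K : ℤ) with hq
  let N1 : ℤ := ∑ x, ∑ p : K, ∑ r : K, ∑ s : K, ind ℤ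
    (QQ (g0 x) (g1 x) (g2 x) (g3 x) (g4 x) p r s = 0 ∧ p*r*(s*(g0 x)+(g3 x)) = 0 ∧
    p*(s*((g1 x)+(g2 x))+r*(g1 x)+(g4 x)) = 0 ∧ r*(s*((g1 x)+(g2 x))+p*(g2 x)+(g4 x)) = 0)
  let N2 : ℤ := ∑ x, ∑ e : K, ind ℤ
    (e*(g0 x)+(g1 x)+(g2 x) = 0 ∧ e*(g1 x) = 0 ∧ e*(g2 x) = 0 ∧ e*(g3 x)+(g4 x) = 0)
  have hi : ∀ P : Prop, ((ind ℤ P : ℤ) : ZMod (Fintype.card K)) = ind _ P := by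
    intro P; simp only [ind]; split_ifs <;> simp
  have hN : q ∣ N1 - N2 := by
    rw [hq, ← ZMod.intCast_zmod_eq_zero_iff_dvd]
    rw [Finset.sum_sub_distrib] at hs
    rw [← hs]
    simp only [N1, N2, n1, n2, Int.cast_sub, Int.cast_sum, hi]
  have c1 : (Nat.card {z : X × (Fin 2 ⊕ Fin 4 → K) //
      Q1 (g0 z.1) (g1 z.1) (g2 z.1) (g3 z.1) (g4 z.1) z.2 = 0} : ℤ) ≡ 
      (Fintype.card X : ℤ) * q ^ 3 * q ^ 2 - q ^ 2 * N1 [ZMOD q ^ 3] := by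
    have e1 : (Nat.card {z : X × (Fin 2 ⊕ Fin 4 → K) //
      Q1 (g0 z.1) (g1 z.1) (g2 z.1) (g3 z.1) (g4 z.1) z.2 = 0} : ℤ) =
      ∑ x, ∑ p : K, ∑ r : K, ∑ s : K, ∑ y1 : K, ∑ y2 : K, ∑ y3 : K,
       if Q1 (g0 x) (g1 x) (g2 x) (g3 x) (g4 x) (Sum.elim ![s, y1] ![p, r, y2, y3]) = 0
        then 1 else 0 := by
      rw [Finset.sum_congr rfl fun x _ => (sum8 (fun y =>
        if Q1 (g0 x) (g1 x) (g2 x) (g3 x) (g4 x) y = 0 then (1:ℤ) else 0)).symm]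
      rw [← Fintype.sum_prod_type (f := fun z : X × (Fin 2 ⊕ Fin 4 → K) =>
         if Q1 (g0 z.1) (g1 z.1) (g2 z.1) (g3 z.1) (g4 z.1) z.2 = 0 then (1:ℤ) else 0)]
      rw [Nat.card_eq_fintype_card, Fintype.card_subtype]
      simp
    have e2 : (Fintype.card X : ℤ) * q ^ 3 * q ^ 2 - q ^ 2 * N1 = 
      ∑ x, ∑ p : K, ∑ r : K, ∑ s : K, (q ^ 2 - q ^ 2 * ind ℤ
    (QQ (g0 x) (g1 x) (g2 x) (g3 x) (g4 x) p r s = 0 ∧ p*r*(s*(g0 x)+(g3 x)) = 0 ∧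
    p*(s*((g1 x)+(g2 x))+r*(g1 x)+(g4 x)) = 0 ∧ r*(s*((g1 x)+(g2 x))+p*(g2 x)+(g4 x)) = 0)) := by
      simp only [Finset.sum_sub_distrib, ← Finset.mul_sum, N1]
      simp [q]
      ring
    rw [e1, e2]
    refine sum_modEq _ _ _ _ fun x _ => sum_modEq _ _ _ _ fun p _ => sum_modEq _ _ _ _ fun r _ =>
      sum_modEq _ _ _ _ fun s _ => ?_
    simp only [Q1_elim]
    exact star_mod _ _ _ _ _ (rel1 _ _ _ _ _ p r s (h x))
  have c2 : (Nat.card {z : X × (Fin 1 ⊕ Fin 3 → K) //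
      Q2 (g0 z.1) (g1 z.1) (g2 z.1) (g3 z.1) (g4 z.1) z.2 = 0} : ℤ) ≡ 
      (Fintype.card X : ℤ) * q * q ^ 2 - q ^ 2 * N2 [ZMOD q ^ 3] := by
    have e1 : (Nat.card {z : X × (Fin 1 ⊕ Fin 3 → K) //
      Q2 (g0 z.1) (g1 z.1) (g2 z.1) (g3 z.1) (g4 z.1) z.2 = 0} : ℤ) =
      ∑ x, ∑ e : K, ∑ y1 : K, ∑ y2 : K, ∑ y3 : K,
       if Q2 (g0 x) (g1 x) (g2 x) (g3 x) (g4 x) (Sum.elim ![y3] ![y1, y2, e]) = 0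
        then 1 else 0 := by
      rw [Finset.sum_congr rfl fun x _ => (sum5 (fun y =>
        if Q2 (g0 x) (g1 x) (g2 x) (g3 x) (g4 x) y = 0 then (1:ℤ) else 0)).symm]
      rw [← Fintype.sum_prod_type (f := fun z : X × (Fin 1 ⊕ Fin 3 → K) =>
         if Q2 (g0 z.1) (g1 z.1) (g2 z.1) (g3 z.1) (g4 z.1) z.2 = 0 then (1:ℤ) else 0)]
      rw [Nat.card_eq_fintype_card, Fintype.card_subtype]
      simp
    have e2 : (Fintype.card X : ℤ) * q * q ^ 2 - q ^ 2 * N2 = 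
      ∑ x, ∑ e : K, (q ^ 2 - q ^ 2 * ind ℤ
        (e*(g0 x)+(g1 x)+(g2 x) = 0 ∧ e*(g1 x) = 0 ∧ e*(g2 x) = 0 ∧ e*(g3 x)+(g4 x) = 0)) := by
      simp only [Finset.sum_sub_distrib, ← Finset.mul_sum, N2]
      simp [q]
      ring
    rw [e1, e2]
    refine sum_modEq _ _ _ _ fun x _ => sum_modEq _ _ _ _ fun e _ => ?_
    simp only [Q2_elim]
    refine star_mod _ _ _ _ (e * g4 x) ?_
    have := h x
    linear_combination e^2 * this
  refine (c1.trans ?_).trans c2.symm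
  rw [Int.modEq_iff_dvd]
  obtain ⟨k, hk⟩ := hN
  refine ⟨(Fintype.card X : ℤ) - (Fintype.card X : ℤ) * q ^ 2 + k, ?_⟩
  linear_combination q^2 * hk
end partD2

section partE0
variable {K : Type} [Field K] [Fintype K]
variable {E V : Type} [Fintype E] [Fintype V] [DecidableEq E] [DecidableEq V]

theorem MM_symm (B : Matrix E V K) (x : E → K) : (MM B x)ᵀ = MM B x := by
  rw [MM, fromBlocks_transpose]; simp

theorem adj_symm (B : Matrix E V K) (x : E → K) (i j : E ⊕ V) :
    (MM B x).adjugate i j = (MM B x).adjugate j i := by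
  have := adjugate_transpose (MM B x)
  rw [MM_symm] at this
  exact congrFun (congrFun this j) i

theorem MB_ne (B : Matrix E V K) (u w : V → K) (x : E → K) (z : K)
    (h : (Sum.elim 0 u : E ⊕ V → K) ⬝ᵥ (MM B x).adjugate *ᵥ (Sum.elim 0 w : E ⊕ V → K) = z ∨
     (Sum.elim 0 u : E ⊕ V → K) ⬝ᵥ (MM B x).adjugate *ᵥ (Sum.elim 0 w : E ⊕ V → K) = -z) :
    det (MB B u w x) ≠ 0 ↔ z ≠ 0 := by
  rw [MB, MB_det _ (MM_symm B x)]
  rcases h with h | h <;> rw [h] <;> simp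

theorem elim_single (c : V) : (Sum.elim 0 (Pi.single c 1) : E ⊕ V → K) = Pi.single (Sum.inr c) 1 := by
  ext i; rcases i with i | i <;> simp [Pi.single_apply]

theorem elim_sub (u w : V → K) : (Sum.elim 0 (u - w) : E ⊕ V → K) =
    (Sum.elim 0 u : E ⊕ V → K) - (Sum.elim 0 w : E ⊕ V → K) := by
  ext i; rcases i with i | i <;> simp

theorem core (B : Matrix E V K) (c d : V) (h1 : 1 < Fintype.card V)
    (h2 : Fintype.card E + 1 < 2 * Fintype.card V) :
    Nat.card {z : (E → K) × (Fin 2 ⊕ Fin 4 → K) //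
      det (bord (MM B z.1) (Sum.inr c) (Sum.inr d) c8 d8 (S8 z.2)) = 0} ≡
    Nat.card {z : (E → K) × (Fin 1 ⊕ Fin 3 → K) //
      det (bord (MM B z.1) (Sum.inr c) (Sum.inr d) c5 d5 (S5 z.2)) = 0}
      [MOD (Fintype.card K) ^ 3] := by
  simp only [bord8 _ (MM_symm B _), bord5 _ (MM_symm B _), neg_eq_zero]
  have hrel : ∀ x, det (MM B x) * G4 (MM B x) (Sum.inr c) (Sum.inr d) =
      ((MM B x).adjugate (Sum.inr c) (Sum.inr d) - (MM B x).adjugate (Sum.inr c) (Sum.inr c)) *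
      ((MM B x).adjugate (Sum.inr c) (Sum.inr d) - (MM B x).adjugate (Sum.inr d) (Sum.inr d)) +
      ((MM B x).adjugate (Sum.inr c) (Sum.inr d) - (MM B x).adjugate (Sum.inr c) (Sum.inr c)) *
      (-(MM B x).adjugate (Sum.inr c) (Sum.inr d)) +
      ((MM B x).adjugate (Sum.inr c) (Sum.inr d) - (MM B x).adjugate (Sum.inr d) (Sum.inr d)) *
      (-(MM B x).adjugate (Sum.inr c) (Sum.inr d)) := by
    intro x
    rw [G4_rel _ (MM_symm B x)]
    ring
  refine D_final (fun x => det (MM B x)) (fun x => (MM B x).adjugate (Sum.inr c) (Sum.inr d)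
      - (MM B x).adjugate (Sum.inr c) (Sum.inr c))
    (fun x => (MM B x).adjugate (Sum.inr c) (Sum.inr d)
      - (MM B x).adjugate (Sum.inr d) (Sum.inr d))
    (fun x => - (MM B x).adjugate (Sum.inr c) (Sum.inr d))
    (fun x => G4 (MM B x) (Sum.inr c) (Sum.inr d)) hrel ?_
  rw [Finset.sum_congr rfl fun x _ => n1_sub_n2 _ _ _ _ _ (hrel x)]
  let δc : V → K := Pi.single c 1
  let δd : V → K := Pi.single d 1
  have m12 := fun x : E → K => MB_ne B (δc - δd) (δc - δd) x
    ((MM B x).adjugate (Sum.inr c) (Sum.inr d) - (MM B x).adjugate (Sum.inr c) (Sum.inr c) +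
    ((MM B x).adjugate (Sum.inr c) (Sum.inr d) - (MM B x).adjugate (Sum.inr d) (Sum.inr d))) (by
      right
      simp only [δc, δd, elim_sub, elim_single, mulVec_sub, dotProduct_sub, sub_dotProduct,
        single_one_dotProduct, mulVec_single_one, col_apply]
      rw [adj_symm B x (Sum.inr d) (Sum.inr c)]; ring)
  have m13 := fun x : E → K => MB_ne B δc δc x
    ((MM B x).adjugate (Sum.inr c) (Sum.inr d) - (MM B x).adjugate (Sum.inr c) (Sum.inr c) +
    -(MM B x).adjugate (Sum.inr c) (Sum.inr d)) (by
      right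
      simp only [δc, δd, elim_sub, elim_single, mulVec_sub, dotProduct_sub, sub_dotProduct,
        single_one_dotProduct, mulVec_single_one, col_apply]
      ring)
  have m23 := fun x : E → K => MB_ne B δd δd x
    ((MM B x).adjugate (Sum.inr c) (Sum.inr d) - (MM B x).adjugate (Sum.inr d) (Sum.inr d) +
    -(MM B x).adjugate (Sum.inr c) (Sum.inr d)) (by
      right
      simp only [δc, δd, elim_sub, elim_single, mulVec_sub, dotProduct_sub, sub_dotProduct,
        single_one_dotProduct, mulVec_single_one, col_apply]
      ring)
  have m1 := fun x : E → K => MB_ne B δc (δd - δc) x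
    ((MM B x).adjugate (Sum.inr c) (Sum.inr d) - (MM B x).adjugate (Sum.inr c) (Sum.inr c)) (by
      left
      simp only [δc, δd, elim_sub, elim_single, mulVec_sub, dotProduct_sub, sub_dotProduct,
        single_one_dotProduct, mulVec_single_one, col_apply])
  have m2 := fun x : E → K => MB_ne B δd (δc - δd) x
    ((MM B x).adjugate (Sum.inr c) (Sum.inr d) - (MM B x).adjugate (Sum.inr d) (Sum.inr d)) (by
      left
      simp only [δc, δd, elim_sub, elim_single, mulVec_sub, dotProduct_sub, sub_dotProduct,
        single_one_dotProduct, mulVec_single_one, col_apply]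
      rw [adj_symm B x (Sum.inr d) (Sum.inr c)])
  simp only [← m12, ← m13, ← m23, ← m1, ← m2]
  simp only [Finset.sum_add_distrib, Finset.sum_sub_distrib, ← Finset.mul_sum]
  rw [sum_MM B (by omega), sum_MB B _ _ h1, sum_MB B _ _ h1, sum_MB B _ _ h1, sum_MB B _ _ h1,
    sum_MMMB B _ _ h2, sum_MMMB B _ _ h2, sum_MMMB B _ _ h2, sum_MMMB B _ _ h2,
    sum_MMMB B _ _ h2]
  ring
end partE0

section partE1
variable {K : Type} [Field K]
variable {E V W : Type} [Fintype E] [Fintype V] [DecidableEq E] [DecidableEq V]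

def reE (E L R V X : Type) : (E ⊕ V) ⊕ ((X ⊕ L) ⊕ R) ≃ (E ⊕ (L ⊕ R)) ⊕ (V ⊕ X) where
  toFun := Sum.elim (Sum.elim (fun e => Sum.inl (Sum.inl e)) (fun v => Sum.inr (Sum.inl v)))
    (Sum.elim (Sum.elim (fun x => Sum.inr (Sum.inr x)) (fun l => Sum.inl (Sum.inr (Sum.inl l))))
      (fun r => Sum.inl (Sum.inr (Sum.inr r))))
  invFun := Sum.elim (Sum.elim (fun e => Sum.inl (Sum.inl e))
      (Sum.elim (fun l => Sum.inr (Sum.inl (Sum.inr l))) (fun r => Sum.inr (Sum.inr r))))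
    (Sum.elim (fun v => Sum.inl (Sum.inr v)) (fun x => Sum.inr (Sum.inl (Sum.inl x))))
  left_inv := by rintro ((e | v) | ((x | l) | r)) <;> rfl
  right_inv := by rintro ((e | (l | r)) | (v | x)) <;> rfl

theorem fb_re {E L R V X : Type} [Fintype E] [Fintype L] [Fintype R] [Fintype V] [Fintype X]
    [DecidableEq E] [DecidableEq L] [DecidableEq R] [DecidableEq V] [DecidableEq X]
    (x : E ⊕ (L ⊕ R) → K) (T : Matrix (E ⊕ (L ⊕ R)) (V ⊕ X) K)
    (c d : V) (v w : R → K) (N : Matrix X L K) (B1 : Matrix X R K)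
    (hEX : ∀ e k, T (Sum.inl e) (Sum.inr k) = 0)
    (hLV : ∀ l k, T (Sum.inr (Sum.inl l)) (Sum.inl k) = 0)
    (hLX : ∀ l k, T (Sum.inr (Sum.inl l)) (Sum.inr k) = N k l)
    (hRX : ∀ l k, T (Sum.inr (Sum.inr l)) (Sum.inr k) = B1 k l)
    (hRV : ∀ l k, T (Sum.inr (Sum.inr l)) (Sum.inl k) =
      (if k = c then v l else 0) + (if k = d then w l else 0)) :
    det (fromBlocks (diagonal x) T Tᵀ 0) =
    det (bord (MM (of fun e k => T (Sum.inl e) (Sum.inl k)) (fun e => x (Sum.inl e)))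
      (Sum.inr c) (Sum.inr d) (Sum.elim 0 v) (Sum.elim 0 w)
      (fromBlocks (fromBlocks 0 N Nᵀ (diagonal fun i => x (Sum.inr (Sum.inl i))))
        (fromRows B1 0) (fromRows B1 0)ᵀ (diagonal fun i => x (Sum.inr (Sum.inr i))))) := by
  rw [← det_submatrix_equiv_self (reE E L R V X)]
  congr 1
  ext i j
  rcases i with ((e | k) | ((z | l) | r)) <;> rcases j with ((e' | k') | ((z' | l') | r')) <;>
    simp [bord, MM, reE, hEX, hLV, hLX, hRX, hRV, diagonal_apply, Matrix.transpose_apply]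

theorem red8 (sJ tJ : E → W) (ιJ : V → W) (hι : Function.Injective ιJ) (a b y : W) (c d : V)
    (hab : a ≠ b) (hay : a ≠ y) (hby : b ≠ y)
    (ha : ∀ v, ιJ v ≠ a) (hb : ∀ v, ιJ v ≠ b) (hy : ∀ v, ιJ v ≠ y)
    (hsa : ∀ e, sJ e ≠ a) (hsb : ∀ e, sJ e ≠ b) (hta : ∀ e, tJ e ≠ a) (htb : ∀ e, tJ e ≠ b)
    (x : E ⊕ (Fin 2 ⊕ Fin 4) → K) :
    det (fromBlocks (diagonal x)
      (incM (Sum.elim sJ (Sum.elim ![a, b] ![a, a, b, b]))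
        (Sum.elim tJ (Sum.elim ![y, a] ![ιJ c, ιJ d, ιJ c, ιJ d])) (Sum.elim ιJ ![a, b]))
      (incM (Sum.elim sJ (Sum.elim ![a, b] ![a, a, b, b]))
        (Sum.elim tJ (Sum.elim ![y, a] ![ιJ c, ιJ d, ιJ c, ιJ d])) (Sum.elim ιJ ![a, b]))ᵀ 0) =
    det (bord (MM (incM sJ tJ ιJ) (fun e => x (Sum.inl e)))
      (Sum.inr c) (Sum.inr d) c8 d8 (S8 fun e => x (Sum.inr e))) := by
  have ht : (!![1,0;-1,1] : Matrix (Fin 2) (Fin 2) K) = (!![1,-1;0,1])ᵀ := by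
    ext i j; fin_cases i <;> fin_cases j <;> rfl
  rw [S8, ht]
  refine fb_re x _ c d _ _ _ _ ?_ ?_ ?_ ?_ ?_
  · intro e k
    fin_cases k <;> simp [incM, hsa, hsb, hta, htb]
  · intro l k
    fin_cases l <;> simp [incM, (ha _).symm, (hb _).symm, (hy _).symm]
  · intro l k
    fin_cases l <;> fin_cases k <;> simp [incM, hab, hab.symm, hay.symm, hby.symm]
  · intro l k
    fin_cases l <;> fin_cases k <;> simp [incM, hab, hab.symm, ha, hb]
  · intro l k
    fin_cases l <;> simp [incM, (ha _).symm, (hb _).symm, hι.eq_iff, eq_comm (a := k)] <;>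
      split_ifs <;> simp

theorem red5 (sJ tJ : E → W) (ιJ : V → W) (hι : Function.Injective ιJ) (a y : W) (c d : V)
    (hay : a ≠ y)
    (ha : ∀ v, ιJ v ≠ a) (hy : ∀ v, ιJ v ≠ y)
    (hsa : ∀ e, sJ e ≠ a) (hta : ∀ e, tJ e ≠ a)
    (x : E ⊕ (Fin 1 ⊕ Fin 3) → K) :
    det (fromBlocks (diagonal x)
      (incM (Sum.elim sJ (Sum.elim ![a] ![a, a, ιJ c]))
        (Sum.elim tJ (Sum.elim ![y] ![ιJ c, ιJ d, ιJ d])) (Sum.elim ιJ ![a]))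
      (incM (Sum.elim sJ (Sum.elim ![a] ![a, a, ιJ c]))
        (Sum.elim tJ (Sum.elim ![y] ![ιJ c, ιJ d, ιJ d])) (Sum.elim ιJ ![a]))ᵀ 0) =
    det (bord (MM (incM sJ tJ ιJ) (fun e => x (Sum.inl e)))
      (Sum.inr c) (Sum.inr d) c5 d5 (S5 fun e => x (Sum.inr e))) := by
  have ht : (fromBlocks 0 1 1 (diagonal fun i => x (Sum.inr (Sum.inl i))) :
    Matrix (Fin 1 ⊕ Fin 1) (Fin 1 ⊕ Fin 1) K) = 
    fromBlocks 0 1 1ᵀ (diagonal fun i => x (Sum.inr (Sum.inl i))) := by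
    rw [transpose_one]
  rw [S5, ht]
  refine fb_re x _ c d _ _ _ _ ?_ ?_ ?_ ?_ ?_
  · intro e k
    fin_cases k; simp [incM, hsa, hta]
  · intro l k
    fin_cases l; simp [incM, (ha _).symm, (hy _).symm]
  · intro l k
    fin_cases l; fin_cases k; simp [incM, hay.symm]
  · intro l k
    fin_cases l <;> fin_cases k <;> simp [incM, ha]
  · intro l k
    fin_cases l <;> simp [incM, (ha _).symm, hι.eq_iff, eq_comm (a := k)] <;>
      split_ifs <;> simp

theorem card_split {E X : Type} (P : (E → K) → (X → K) → Prop) :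
    Nat.card {x : E ⊕ X → K // P (fun e => x (Sum.inl e)) (fun e => x (Sum.inr e))} =
    Nat.card {z : (E → K) × (X → K) // P z.1 z.2} :=
  Nat.card_congr ((Equiv.sumArrowEquivProdArrow E X K).subtypeEquiv fun x => Iff.rfl)
end partE1

section partF

theorem edge_bound {W : Type} [Fintype W] (Γ : SimpleGraph W)
    (hreg : ∀ w : W, Nat.card (Γ.neighborSet w) = 4) (a b x : W) (hab : a ≠ b) (hax : a ≠ x)
    (hbx : b ≠ x) (hn : ¬ Γ.Adj a x) :
    Fintype.card {e : Sym2 W // e ∈ Γ.edgeSet ∧ a ∉ e ∧ b ∉ e ∧ x ∉ e} + 10 ≤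
      2 * Fintype.card W := by
  have hdeg : ∀ v, Γ.degree v = 4 := by
    intro v
    rw [← SimpleGraph.card_neighborSet_eq_degree, ← Nat.card_eq_fintype_card]
    exact hreg v
  have hE : Γ.edgeFinset.card = 2 * Fintype.card W := by
    have := Γ.sum_degrees_eq_twice_card_edges
    simp only [hdeg] at this
    simp at this
    omega
  have hI : ∀ v, (Γ.incidenceFinset v).card = 4 := by
    intro v; rw [SimpleGraph.card_incidenceFinset_eq_degree, hdeg]
  have iab : (Γ.incidenceFinset a ∩ Γ.incidenceFinset b).card ≤ 1 := by
    refine le_trans (Finset.card_le_card (t := {s(a,b)}) ?_) (by simp)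
    intro e he
    have := Γ.incidenceSet_inter_incidenceSet_subset hab (show e ∈ _ ∩ _ by simpa using he)
    simpa using this
  have ibx : (Γ.incidenceFinset b ∩ Γ.incidenceFinset x).card ≤ 1 := by
    refine le_trans (Finset.card_le_card (t := {s(b,x)}) ?_) (by simp)
    intro e he
    have := Γ.incidenceSet_inter_incidenceSet_subset hbx (show e ∈ _ ∩ _ by simpa using he)
    simpa using this
  have iax : (Γ.incidenceFinset a ∩ Γ.incidenceFinset x).card = 0 := by
    rw [Finset.card_eq_zero, Finset.eq_empty_iff_forall_notMem]
    intro e he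
    have h := Γ.incidenceSet_inter_incidenceSet_of_not_adj hn hax
    have : e ∈ Γ.incidenceSet a ∩ Γ.incidenceSet x := by simpa using he
    rw [h] at this
    exact this
  have u1 := Finset.card_union_add_card_inter (Γ.incidenceFinset a) (Γ.incidenceFinset b)
  have u2 := Finset.card_union_add_card_inter (Γ.incidenceFinset a ∪ Γ.incidenceFinset b)
    (Γ.incidenceFinset x)
  have u3 : ((Γ.incidenceFinset a ∪ Γ.incidenceFinset b) ∩ Γ.incidenceFinset x).card ≤ 1 := by
    rw [Finset.union_inter_distrib_right]
    have := Finset.card_union_le (Γ.incidenceFinset a ∩ Γ.incidenceFinset x)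
      (Γ.incidenceFinset b ∩ Γ.incidenceFinset x)
    omega
  have hsub : (Γ.incidenceFinset a ∪ Γ.incidenceFinset b) ∪ Γ.incidenceFinset x ⊆ Γ.edgeFinset := by
    intro e he
    simp only [Finset.mem_union, SimpleGraph.mem_incidenceFinset] at he
    rw [SimpleGraph.mem_edgeFinset]
    rcases he with (he | he) | he <;> exact he.1
  have hJ : Fintype.card {e : Sym2 W // e ∈ Γ.edgeSet ∧ a ∉ e ∧ b ∉ e ∧ x ∉ e} =
      (Γ.edgeFinset \ ((Γ.incidenceFinset a ∪ Γ.incidenceFinset b) ∪ Γ.incidenceFinset x)).card := by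
    rw [Fintype.card_subtype]
    congr 1
    ext e
    simp only [Finset.mem_filter, Finset.mem_univ, true_and, Finset.mem_sdiff, Finset.mem_union,
      SimpleGraph.mem_incidenceFinset, SimpleGraph.mem_edgeFinset, SimpleGraph.incidenceSet,
      Set.mem_setOf_eq]
    tauto
  rw [hJ, Finset.card_sdiff_of_subset hsub]
  rw [hI, hI] at u1
  rw [hI] at u2
  have := Finset.card_le_card hsub
  omega

theorem fourth {W : Type} [Fintype W] (Γ : SimpleGraph W) (a b c d : W)
    (h4 : Nat.card (Γ.neighborSet a) = 4) (hb : Γ.Adj a b) (hc : Γ.Adj a c) (hd : Γ.Adj a d)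
    (hbc : b ≠ c) (hbd : b ≠ d) (hcd : c ≠ d) :
    ∃ y, Γ.Adj a y ∧ y ≠ b ∧ y ≠ c ∧ y ≠ d ∧
      ∀ z, Γ.Adj a z → z = b ∨ z = c ∨ z = d ∨ z = y := by
  have h : (Γ.neighborFinset a).card = 4 := by
    rw [SimpleGraph.card_neighborFinset_eq_degree, ← SimpleGraph.card_neighborSet_eq_degree,
      ← Nat.card_eq_fintype_card]
    exact h4
  have h3 : ({b, c, d} : Finset W).card = 3 := by
    rw [Finset.card_eq_three]; exact ⟨b, c, d, hbc, hbd, hcd, rfl⟩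
  have hs : ({b, c, d} : Finset W) ⊆ Γ.neighborFinset a := by
    intro z hz
    simp only [Finset.mem_insert, Finset.mem_singleton] at hz
    rw [SimpleGraph.mem_neighborFinset]
    rcases hz with rfl | rfl | rfl <;> assumption
  have h1 : (Γ.neighborFinset a \ {b, c, d}).card = 1 := by
    rw [Finset.card_sdiff_of_subset hs, h, h3]
  obtain ⟨y, hy⟩ := Finset.card_eq_one.1 h1
  have hm : ∀ z, (Γ.Adj a z ∧ ¬ (z = b ∨ z = c ∨ z = d)) ↔ z = y := by
    intro z
    have : z ∈ Γ.neighborFinset a \ {b, c, d} ↔ z ∈ ({y} : Finset W) := by rw [hy]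
    simpa only [Finset.mem_sdiff, SimpleGraph.mem_neighborFinset, Finset.mem_insert,
      Finset.mem_singleton] using this
  have hy' := (hm y).2 rfl
  push Not at hy'
  refine ⟨y, hy'.1, hy'.2.1, hy'.2.2.1, hy'.2.2.2, fun z hz => ?_⟩
  have := hm z
  tauto

theorem main_x {W : Type} [Fintype W] (Γ : SimpleGraph W)
    (hreg : ∀ w : W, Nat.card (Γ.neighborSet w) = 4) (a b c d x : W) (hdt : DTConfig Γ a b c d x)
    (hxb : x ≠ b) (K : Type) [Field K] [Fintype K] :
    Xcount (delVert Γ x) K ≡ Xcount (delVert (dtReduced Γ a b c d x) ⟨x, hxb⟩) K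
      [MOD (Fintype.card K) ^ 3] := by
  obtain ⟨hab, hac, hbc, had, hbd, hcd, htri, hbx, hxa, hxc, hxd, hncd, hnax⟩ := hdt
  obtain ⟨y, hay, hyb, hyc, hyd, hNa⟩ := fourth Γ a b c d (hreg a) hab hac had hbc.ne hbd.ne hcd
  obtain ⟨x', hbx', hxa', hxc', hxd', hNb⟩ :=
    fourth Γ b a c d (hreg b) hab.symm hbc hbd hac.ne had.ne hcd
  have hxx : x = x' := by
    rcases hNb x hbx with h | h | h | h
    · exact absurd h hxa
    · exact absurd h hxc
    · exact absurd h hxd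
    · exact h
  subst hxx
  have hyx : y ≠ x := fun h => hnax (h ▸ hay)
  let EJ := {e : Sym2 W // e ∈ Γ.edgeSet ∧ a ∉ e ∧ b ∉ e ∧ x ∉ e}
  let VJ := {u : W // u ≠ a ∧ u ≠ b ∧ u ≠ x ∧ u ≠ y}
  have hex : ∀ e : EJ, ∃ p q : W, s(p, q) = e.1 := by
    rintro ⟨e, he⟩
    induction e using Sym2.ind with
    | _ u v => exact ⟨u, v, rfl⟩
  choose sJ tJ hJ using hex
  have hEJ : ∀ e : EJ, Γ.Adj (sJ e) (tJ e) ∧ sJ e ≠ a ∧ sJ e ≠ b ∧ sJ e ≠ x ∧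
      tJ e ≠ a ∧ tJ e ≠ b ∧ tJ e ≠ x := by
    intro e
    have := e.2
    rw [← hJ e] at this
    simp only [SimpleGraph.mem_edgeSet, Sym2.mem_iff, not_or] at this
    obtain ⟨h1, h2, h3, h4⟩ := this
    exact ⟨h1, Ne.symm h2.1, Ne.symm h3.1, Ne.symm h4.1, Ne.symm h2.2, Ne.symm h3.2, Ne.symm h4.2⟩
  have hJa : ∀ (e : EJ) (u : W), s(sJ e, tJ e) ≠ s(a, u) := by
    intro e u h
    rw [Sym2.eq_iff] at h
    rcases h with h | h
    · exact (hEJ e).2.1 h.1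
    · exact (hEJ e).2.2.2.2.1 h.2
  have hJb : ∀ (e : EJ) (u : W), s(sJ e, tJ e) ≠ s(b, u) := by
    intro e u h
    rw [Sym2.eq_iff] at h
    rcases h with h | h
    · exact (hEJ e).2.2.1 h.1
    · exact (hEJ e).2.2.2.2.2.1 h.2
  have hJcd : ∀ (e : EJ), s(sJ e, tJ e) ≠ s(c, d) := by
    intro e h
    have h1 := (hEJ e).1
    rw [← SimpleGraph.mem_edgeSet, h] at h1
    exact hncd h1
  have hJJ : ∀ e e' : EJ, s(sJ e, tJ e) = s(sJ e', tJ e') → e = e' := by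
    intro e e' h
    rw [hJ, hJ] at h
    exact Subtype.ext h
  have hJs : ∀ u v, Γ.Adj u v → u ≠ x → v ≠ x → u ≠ a → u ≠ b → v ≠ a → v ≠ b →
      ∃ e : EJ, s(sJ e, tJ e) = s(u, v) := by
    intro u v h h1 h2 h3 h4 h5 h6
    refine ⟨⟨s(u, v), h, ?_, ?_, ?_⟩, hJ _⟩ <;>
      simp [h1, h2, h3, h4, h5, h6, h1.symm, h2.symm, h3.symm, h4.symm, h5.symm, h6.symm]
  let ιJ : VJ → W := Subtype.val
  have hι : Function.Injective ιJ := Subtype.val_injective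
  let c' : VJ := ⟨c, hac.ne.symm, hbc.ne.symm, hxc.symm, hyc.symm⟩
  let d' : VJ := ⟨d, had.ne.symm, hbd.ne.symm, hxd.symm, hyd.symm⟩
  have hc' : ιJ c' = c := rfl
  have hd' : ιJ d' = d := rfl
  have e1 : Xcount (delVert Γ x) K = Nat.card {z : (EJ → K) × (Fin 2 ⊕ Fin 4 → K) //
      det (bord (MM (incM sJ tJ ιJ) z.1) (Sum.inr c') (Sum.inr d') c8 d8 (S8 z.2)) = 0} := by
    rw [← card_split (fun z1 z2 =>
      det (bord (MM (incM sJ tJ ιJ) z1) (Sum.inr c') (Sum.inr d') c8 d8 (S8 z2)) = 0)]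
    simp only [← red8 sJ tJ ιJ hι a b y c' d' hab.ne hay.ne hyb.symm (fun v => v.2.1)
      (fun v => v.2.2.1) (fun v => v.2.2.2.2) (fun e => (hEJ e).2.1) (fun e => (hEJ e).2.2.1)
      (fun e => (hEJ e).2.2.2.2.1) (fun e => (hEJ e).2.2.2.2.2.1)]
    refine Xcount_eq' (delVert Γ x) Subtype.val Subtype.val_injective K _ _ ?_ ?_ ?_ _ ⟨y, hyx⟩
      ?_ ?_ ?_
    · have key : ∀ u v : W, u ≠ x → v ≠ x → Γ.Adj u v →
          ∃ u' v' : ↥{u : W | u ≠ x}, u'.1 = u ∧ v'.1 = v ∧ (delVert Γ x).Adj u' v' :=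
        fun u v hu hv h => ⟨⟨u, hu⟩, ⟨v, hv⟩, rfl, rfl, h⟩
      rintro (e | (e | e))
      · exact key _ _ (hEJ e).2.2.2.1 (hEJ e).2.2.2.2.2.2 (hEJ e).1
      · fin_cases e
        · exact key _ _ hxa.symm hyx hay
        · exact key _ _ hxb.symm hxa.symm hab.symm
      · fin_cases e
        · exact key _ _ hxa.symm hxc.symm hac
        · exact key _ _ hxa.symm hxd.symm had
        · exact key _ _ hxb.symm hxc.symm hbc
        · exact key _ _ hxb.symm hxd.symm hbd
    · have nab := hab.ne
      have nac := hac.ne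
      have nad := had.ne
      have nbc := hbc.ne
      have nbd := hbd.ne
      have nay := hay.ne
      rintro (e | (e | e)) (e' | (e' | e')) h
      · rw [hJJ e e' h]
      · exfalso; fin_cases e'
        · exact hJa _ _ h
        · exact hJb _ _ h
      · exfalso; fin_cases e'
        · exact hJa _ _ h
        · exact hJa _ _ h
        · exact hJb _ _ h
        · exact hJb _ _ h
      · exfalso; fin_cases e
        · exact hJa _ _ h.symm
        · exact hJb _ _ h.symm
      · fin_cases e <;> fin_cases e' <;>
          simp [nab, nab.symm, nay, nay.symm, hyb, hyb.symm] at h ⊢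
      · fin_cases e <;> fin_cases e' <;>
          simp [nab, nab.symm, nay, nay.symm, hyb, hyb.symm, nac, nac.symm, nad, nad.symm,
            nbc, nbc.symm, nbd, nbd.symm, hyc, hyd, hc', hd', hcd, hcd.symm] at h ⊢
      · exfalso; fin_cases e
        · exact hJa _ _ h.symm
        · exact hJa _ _ h.symm
        · exact hJb _ _ h.symm
        · exact hJb _ _ h.symm
      · fin_cases e <;> fin_cases e' <;>
          simp [nab, nab.symm, nay, nay.symm, hyb, hyb.symm, nac, nac.symm, nad, nad.symm,
            nbc, nbc.symm, nbd, nbd.symm, hyc, hyd, hyc.symm, hyd.symm, hc', hd', hcd,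
            hcd.symm] at h ⊢
      · fin_cases e <;> fin_cases e' <;>
          simp [nab, nab.symm, nay, nay.symm, hyb, hyb.symm, nac, nac.symm, nad, nad.symm,
            nbc, nbc.symm, nbd, nbd.symm, hyc, hyd, hc', hd', hcd, hcd.symm] at h ⊢
    · have ka : ∀ v : W, v ≠ x → Γ.Adj a v → ∃ e, s((Sum.elim sJ (Sum.elim ![a, b] ![a, a, b, b]) :
          EJ ⊕ (Fin 2 ⊕ Fin 4) → W) e,
          (Sum.elim tJ (Sum.elim ![y, a] ![ιJ c', ιJ d', ιJ c', ιJ d']) :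
          EJ ⊕ (Fin 2 ⊕ Fin 4) → W) e) = s(a, v) := by
        intro v hv h
        rcases hNa v h with rfl | rfl | rfl | rfl
        · exact ⟨Sum.inr (Sum.inl 1), Sym2.eq_swap⟩
        · exact ⟨Sum.inr (Sum.inr 0), rfl⟩
        · exact ⟨Sum.inr (Sum.inr 1), rfl⟩
        · exact ⟨Sum.inr (Sum.inl 0), rfl⟩
      have kb : ∀ v : W, v ≠ x → Γ.Adj b v → ∃ e, s((Sum.elim sJ (Sum.elim ![a, b] ![a, a, b, b]) :
          EJ ⊕ (Fin 2 ⊕ Fin 4) → W) e,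
          (Sum.elim tJ (Sum.elim ![y, a] ![ιJ c', ιJ d', ιJ c', ιJ d']) :
          EJ ⊕ (Fin 2 ⊕ Fin 4) → W) e) = s(b, v) := by
        intro v hv h
        rcases hNb v h with rfl | rfl | rfl | rfl
        · exact ⟨Sum.inr (Sum.inl 1), rfl⟩
        · exact ⟨Sum.inr (Sum.inr 2), rfl⟩
        · exact ⟨Sum.inr (Sum.inr 3), rfl⟩
        · exact absurd rfl hv
      rintro ⟨u, hu⟩ ⟨v, hv⟩ h
      have h : Γ.Adj u v := h
      have hu : u ≠ x := hu
      have hv : v ≠ x := hv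
      change ∃ e, _ = s(u, v)
      by_cases h1 : u = a
      · subst h1; exact ka v hv h
      by_cases h2 : u = b
      · subst h2; exact kb v hv h
      by_cases h3 : v = a
      · subst h3; rw [Sym2.eq_swap]; exact ka u hu h.symm
      by_cases h4 : v = b
      · subst h4; rw [Sym2.eq_swap]; exact kb u hu h.symm
      obtain ⟨e, he⟩ := hJs u v h hu hv h1 h2 h3 h4
      exact ⟨Sum.inl e, he⟩
    · rintro (i | i) (i' | i') h
      · rw [hι h]
      · exfalso; fin_cases i'
        · exact i.2.1 h
        · exact i.2.2.1 h
      · exfalso; fin_cases i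
        · exact i'.2.1 h.symm
        · exact i'.2.2.1 h.symm
      · fin_cases i <;> fin_cases i' <;> simp [hab.ne, hab.ne.symm] at h ⊢
    · have key : ∀ u : W, u ≠ x → u ≠ y → ∃ v : ↥{u : W | u ≠ x}, v ≠ ⟨y, hyx⟩ ∧ v.1 = u :=
        fun u h1 h2 => ⟨⟨u, h1⟩, fun h => h2 (congrArg Subtype.val h), rfl⟩
      rintro (i | i)
      · exact key _ i.2.2.2.1 i.2.2.2.2
      · fin_cases i
        · exact key _ hxa.symm hay.ne
        · exact key _ hxb.symm hyb.symm
    · rintro ⟨v, hv⟩ h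
      have hv : v ≠ x := hv
      have h : v ≠ y := fun hh => h (Subtype.ext hh)
      by_cases h1 : v = a
      · exact ⟨Sum.inr 0, h1.symm⟩
      by_cases h2 : v = b
      · exact ⟨Sum.inr 1, h2.symm⟩
      exact ⟨Sum.inl ⟨v, h1, h2, hv, h⟩, rfl⟩
  have e2 : Xcount (delVert (dtReduced Γ a b c d x) ⟨x, hxb⟩) K =
      Nat.card {z : (EJ → K) × (Fin 1 ⊕ Fin 3 → K) //
      det (bord (MM (incM sJ tJ ιJ) z.1) (Sum.inr c') (Sum.inr d') c5 d5 (S5 z.2)) = 0} := by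
    rw [← card_split (fun z1 z2 =>
      det (bord (MM (incM sJ tJ ιJ) z1) (Sum.inr c') (Sum.inr d') c5 d5 (S5 z2)) = 0)]
    simp only [← red5 sJ tJ ιJ hι a y c' d' hay.ne (fun v => v.2.1)
      (fun v => v.2.2.2.2) (fun e => (hEJ e).2.1) 
      (fun e => (hEJ e).2.2.2.2.1)]
    refine Xcount_eq' (delVert (dtReduced Γ a b c d x) ⟨x, hxb⟩) (fun u => u.1.1)
      (Subtype.val_injective.comp Subtype.val_injective) K _ _ ?_ ?_ ?_ _
      ⟨⟨y, hyb⟩, fun h => hyx (congrArg Subtype.val h)⟩ ?_ ?_ ?_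
    · have key : ∀ u v : W, u ≠ x → v ≠ x → u ≠ b → v ≠ b → u ≠ v →
          (Γ.Adj u v ∨ (u = c ∧ v = d)) →
          ∃ u' v' : ↥{u : {u : W // u ≠ b} | u ≠ ⟨x, hxb⟩}, u'.1.1 = u ∧ v'.1.1 = v ∧
            (delVert (dtReduced Γ a b c d x) ⟨x, hxb⟩).Adj u' v' := by
        intro u v hu hv hub hvb huv h
        refine ⟨⟨⟨u, hub⟩, fun h => hu (congrArg Subtype.val h)⟩,
          ⟨⟨v, hvb⟩, fun h => hv (congrArg Subtype.val h)⟩, rfl, rfl, ?_⟩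
        refine ⟨fun h => huv (congrArg Subtype.val h), Or.inl ?_⟩
        rcases h with h | h
        · exact Or.inl h
        · exact Or.inr (Or.inl h)
      rintro (e | (e | e))
      · exact key _ _ (hEJ e).2.2.2.1 (hEJ e).2.2.2.2.2.2 (hEJ e).2.2.1 (hEJ e).2.2.2.2.2.1
          (hEJ e).1.ne (Or.inl (hEJ e).1)
      · fin_cases e
        exact key _ _ hxa.symm hyx hab.ne hyb hay.ne (Or.inl hay)
      · fin_cases e
        · exact key _ _ hxa.symm hxc.symm hab.ne hbc.ne.symm hac.ne (Or.inl hac)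
        · exact key _ _ hxa.symm hxd.symm hab.ne hbd.ne.symm had.ne (Or.inl had)
        · exact key _ _ hxc.symm hxd.symm hbc.ne.symm hbd.ne.symm hcd (Or.inr ⟨rfl, rfl⟩)
    · have nac := hac.ne
      have nad := had.ne
      have nay := hay.ne
      rintro (e | (e | e)) (e' | (e' | e')) h
      · rw [hJJ e e' h]
      · exfalso; fin_cases e'
        exact hJa _ _ h
      · exfalso; fin_cases e'
        · exact hJa _ _ h
        · exact hJa _ _ h
        · exact hJcd _ h
      · exfalso; fin_cases e
        exact hJa _ _ h.symm
      · fin_cases e; fin_cases e'; rfl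
      · fin_cases e <;> fin_cases e' <;>
          simp [nay, nay.symm, nac, nac.symm, nad, nad.symm,
            hyc, hyd, hyc.symm, hyd.symm, hc', hd', hcd, hcd.symm] at h ⊢
      · exfalso; fin_cases e
        · exact hJa _ _ h.symm
        · exact hJa _ _ h.symm
        · exact hJcd _ h.symm
      · fin_cases e <;> fin_cases e' <;>
          simp [nay, nay.symm, nac, nac.symm, nad, nad.symm,
            hyc, hyd, hyc.symm, hyd.symm, hc', hd', hcd, hcd.symm] at h ⊢
      · fin_cases e <;> fin_cases e' <;>
          simp [nay, nay.symm, nac, nac.symm, nad, nad.symm,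
            hyc, hyd, hyc.symm, hyd.symm, hc', hd', hcd, hcd.symm] at h ⊢
    · have ka : ∀ v : W, v ≠ b → Γ.Adj a v → ∃ e, s((Sum.elim sJ (Sum.elim ![a] ![a, a, ιJ c']) :
          EJ ⊕ (Fin 1 ⊕ Fin 3) → W) e,
          (Sum.elim tJ (Sum.elim ![y] ![ιJ c', ιJ d', ιJ d']) :
          EJ ⊕ (Fin 1 ⊕ Fin 3) → W) e) = s(a, v) := by
        intro v hv h
        rcases hNa v h with rfl | rfl | rfl | rfl
        · exact absurd rfl hv
        · exact ⟨Sum.inr (Sum.inr 0), rfl⟩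
        · exact ⟨Sum.inr (Sum.inr 1), rfl⟩
        · exact ⟨Sum.inr (Sum.inl 0), rfl⟩
      rintro ⟨⟨u, hub⟩, hu⟩ ⟨⟨v, hvb⟩, hv⟩ h
      have hu : u ≠ x := fun hh => hu (Subtype.ext hh)
      have hv : v ≠ x := fun hh => hv (Subtype.ext hh)
      have h : (Γ.Adj u v ∨ (u = c ∧ v = d) ∨ (u = a ∧ v = x)) ∨
        (Γ.Adj v u ∨ (v = c ∧ u = d) ∨ (v = a ∧ u = x)) := h.2
      change ∃ e, _ = s(u, v)
      have h' : Γ.Adj u v ∨ (u = c ∧ v = d) ∨ (v = c ∧ u = d) := by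
        rcases h with (h | h | h) | (h | h | h)
        · exact Or.inl h
        · exact Or.inr (Or.inl h)
        · exact absurd h.2 hv
        · exact Or.inl h.symm
        · exact Or.inr (Or.inr h)
        · exact absurd h.2 hu
      rcases h' with hA | ⟨rfl, rfl⟩ | ⟨rfl, rfl⟩
      · by_cases h1 : u = a
        · subst h1; exact ka v hvb hA
        by_cases h3 : v = a
        · subst h3; rw [Sym2.eq_swap]; exact ka u hub hA.symm
        obtain ⟨e, he⟩ := hJs u v hA hu hv h1 hub h3 hvb
        exact ⟨Sum.inl e, he⟩
      · exact ⟨Sum.inr (Sum.inr 2), rfl⟩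
      · exact ⟨Sum.inr (Sum.inr 2), Sym2.eq_swap⟩
    · rintro (i | i) (i' | i') h
      · rw [hι h]
      · exfalso; fin_cases i'
        exact i.2.1 h
      · exfalso; fin_cases i
        exact i'.2.1 h.symm
      · fin_cases i; fin_cases i'; rfl
    · have key : ∀ u : W, u ≠ x → u ≠ y → u ≠ b →
          ∃ v : ↥{u : {u : W // u ≠ b} | u ≠ ⟨x, hxb⟩},
          v ≠ ⟨⟨y, hyb⟩, fun h => hyx (congrArg Subtype.val h)⟩ ∧ v.1.1 = u :=
        fun u h1 h2 h3 => ⟨⟨⟨u, h3⟩, fun h => h1 (congrArg Subtype.val h)⟩,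
          fun h => h2 (congrArg (fun z => z.1.1) h), rfl⟩
      rintro (i | i)
      · exact key _ i.2.2.2.1 i.2.2.2.2 i.2.2.1
      · fin_cases i
        exact key _ hxa.symm hay.ne hab.ne
    · rintro ⟨⟨v, hvb⟩, hv⟩ h
      have hv : v ≠ x := fun hh => hv (Subtype.ext hh)
      have h : v ≠ y := fun hh => h (Subtype.ext (Subtype.ext hh))
      by_cases h1 : v = a
      · exact ⟨Sum.inr 0, h1.symm⟩
      exact ⟨Sum.inl ⟨v, h1, hvb, hv, h⟩, rfl⟩
  rw [e1, e2]
  have hV : Fintype.card VJ + 4 = Fintype.card W := by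
    have : Fintype.card VJ = (({a, b, x, y} : Finset W)ᶜ).card := by
      rw [Fintype.card_subtype]
      congr 1
      ext u; simp
    rw [this, Finset.card_compl]
    have h4 : ({a, b, x, y} : Finset W).card = 4 := by
      simp [Finset.card_insert_of_notMem, hab.ne, hxa.symm, hay.ne, hxb.symm, hyb.symm, hyx.symm]
    have := Finset.card_le_univ ({a, b, x, y} : Finset W)
    omega
  have hEc := edge_bound Γ hreg a b x hab.ne hxa.symm hxb.symm hnax
  refine core (incM sJ tJ ιJ) c' d' (Fintype.one_lt_card_iff.2 ⟨c', d', ?_⟩) ?_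
  · intro h; exact hcd (congrArg Subtype.val h)
  · change Fintype.card EJ + 10 ≤ _ at hEc
    omega
end partF

theorem stmt7 (hCC : CompletionConjecture) {W : Type} [Fintype W] (Γ₁ : SimpleGraph W)
    (hΓ₁ : IsCompletedPrimitive Γ₁) (a b c d x : W) (hdt : DTConfig Γ₁ a b c d x)
    (hΓ₂ : IsCompletedPrimitive (dtReduced Γ₁ a b c d x))
    (v₁ : W) (v₂ : {u : W // u ≠ b}) (K : Type) [Field K] [Fintype K] :
    Xcount (delVert Γ₁ v₁) K ≡ Xcount (delVert (dtReduced Γ₁ a b c d x) v₂) K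
      [MOD (Fintype.card K) ^ 3] := by
  have hxb : x ≠ b := hdt.2.2.2.2.2.2.2.1.ne.symm
  exact ((hCC W Γ₁ hΓ₁ v₁ x K).trans (main_x Γ₁ hΓ₁.2.1 a b c d x hdt hxb K)).trans
    (hCC _ _ hΓ₂ ⟨x, hxb⟩ v₂ K)
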